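/- arXiv:2508.17217 — 2 statements merged into one kernel-verified Lean document; each statement's English description precedes it below -/
import Mathlib

section
/- Fix 0 < α < 1/2, 0 < κ < 1/2, ε > 0, an integer d ≥ 2, and a function g : ℝ → ℝ with g(x) → ∞ as x → ∞. Set R = R(x) = (log log log x)/g(x). Then there exist a constant C > 0 and a threshold x0 such that for all x ≥ x0, all y with x^κ ≤ y ≤ x, all k with 1 ≤ k < y^{1−α}, and all a with gcd(a,k) = 1: ∑_{x ≤ n ≤ x+y, n ≡ a (mod k)} τ_d(n)^R ≤ C · (x (log x)^ε / φ(k)) · ((φ(k)/k) · log x)^{d^R − 1}. -/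
open Finset

noncomputable section

/-- The `d`-fold divisor function: the number of ordered `d`-tuples of positive
integers whose product is `n`. -/
def taud (d n : ℕ) : ℕ := Nat.card {v : Fin d → ℕ // ∏ i, v i = n}

namespace DivisorBound

open Real

open scoped ArithmeticFunction.zeta ArithmeticFunction.Moebius

lemma sum_log_div_prime_mul_le (N : ℕ) :
    ∑ p ∈ (Finset.range (N + 1)).filter Nat.Prime, ((N / p : ℕ) : ℝ) * log p ≤ log (N.factorial) := by
  have hdvd : ∏ p ∈ (Finset.range (N + 1)).filter Nat.Prime, p ^ (N / p) ∣ N.factorial := by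
    apply Finset.prod_dvd_of_isRelPrime
    · intro p hp q hq hpq
      simp only [Finset.coe_filter, Set.mem_ofPred_eq] at hp hq
      exact Nat.coprime_iff_isRelPrime.mp
        (Nat.Coprime.pow _ _ ((Nat.coprime_primes hp.2 hq.2).mpr hpq))
    · intro p hp
      simp only [Finset.mem_filter] at hp
      rw [hp.2.pow_dvd_factorial_iff (Nat.lt_succ_self (Nat.log p N))]
      by_cases h : N < p
      · simp [Nat.div_eq_of_lt h]
      · have hlog : 1 ≤ Nat.log p N := Nat.log_pos hp.2.one_lt (not_lt.mp h)
        calc N / p = N / p ^ 1 := by rw [pow_one]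
          _ ≤ _ := Finset.single_le_sum (f := fun i => N / p ^ i) (fun _ _ => Nat.zero_le _)
            (Finset.mem_Ico.mpr ⟨le_rfl, by omega⟩)
  have hle := Nat.le_of_dvd (Nat.factorial_pos N) hdvd
  have hpos : 0 < ∏ p ∈ (Finset.range (N + 1)).filter Nat.Prime, p ^ (N / p) :=
    Finset.prod_pos fun p hp => pow_pos (Finset.mem_filter.mp hp).2.pos _
  calc _ = log ((∏ p ∈ (Finset.range (N + 1)).filter Nat.Prime, p ^ (N / p) : ℕ) : ℝ) := by
        push_cast
        rw [Real.log_prod]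
        · simp
        · intro p hp
          have := (Finset.mem_filter.mp hp).2.pos
          positivity
    _ ≤ _ := Real.log_le_log (by exact_mod_cast hpos) (by exact_mod_cast hle)

lemma sum_log_div_prime_le {N : ℕ} (hN : 1 ≤ N) :
    ∑ p ∈ (Finset.range (N + 1)).filter Nat.Prime, log p / p ≤ log N + log 4 := by
  have h1 := sum_log_div_prime_mul_le N
  have h2 : log (N.factorial) ≤ N * log N := by
    rw [← Real.log_pow]
    exact Real.log_le_log (by exact_mod_cast Nat.factorial_pos N)
      (by exact_mod_cast Nat.factorial_le_pow N)
  have h3 : ∑ p ∈ (Finset.range (N + 1)).filter Nat.Prime, log p ≤ N * log 4 := by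
    have := Chebyshev.theta_le_log4_mul_x (x := (N : ℝ)) (by positivity)
    rw [Chebyshev.theta_eq_sum_primesLE_log] at this
    rw [mul_comm]
    exact this
  have h4 : ∑ p ∈ (Finset.range (N + 1)).filter Nat.Prime, ((N : ℝ) * (log p / p) - log p) ≤
      ∑ p ∈ (Finset.range (N + 1)).filter Nat.Prime, ((N / p : ℕ) : ℝ) * log p := by
    apply Finset.sum_le_sum
    intro p hp
    have hp' := (Finset.mem_filter.mp hp).2
    have hf : (N : ℝ) / p - 1 ≤ ((N / p : ℕ) : ℝ) := by
      have := Nat.lt_floor_add_one ((N : ℝ) / p)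
      rw [Nat.floor_div_eq_div] at this
      linarith
    have hl : 0 ≤ log p := Real.log_natCast_nonneg p
    calc (N : ℝ) * (log p / p) - log p = (N / p - 1) * log p := by ring
      _ ≤ _ := by gcongr
  rw [Finset.sum_sub_distrib, ← Finset.mul_sum] at h4
  have hN' : (0 : ℝ) < N := by exact_mod_cast hN
  have : (N : ℝ) * ∑ p ∈ (Finset.range (N + 1)).filter Nat.Prime, log p / p
      ≤ N * (log N + log 4) := by linarith
  exact le_of_mul_le_mul_left this hN'

lemma sum_inv_prime_sub_le {N : ℕ} (hN : 2 ≤ N) :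
    ∑ p ∈ (Finset.range (N + 1)).filter Nat.Prime, 1 / (p : ℝ) ≤
      (∑ p ∈ (Finset.range (N + 1)).filter Nat.Prime, log p / p) / log N
        + log (log N) - log 4 / log N + (log 4 / log 2 - log (log 2)) := by
  induction N, hN using Nat.le_induction with
  | base =>
    have h2 : (0 : ℝ) < log 2 := Real.log_pos (by norm_num)
    have : (Finset.range (2 + 1)).filter Nat.Prime = {2} := by decide
    rw [this]
    simp only [Finset.sum_singleton]
    push_cast
    have : log 2 / 2 / log 2 = 1 / 2 := by field_simp
    rw [this]
    linarith
  | succ N hN ih =>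
    have hN1 : (1 : ℝ) < N := by exact_mod_cast hN
    have hu : 0 < log (N : ℝ) := Real.log_pos hN1
    have huv : log (N : ℝ) ≤ log ((N + 1 : ℕ) : ℝ) :=
      Real.log_le_log (by linarith) (by push_cast; linarith)
    have hA := sum_log_div_prime_le (N := N) (by omega)
    set u := log (N : ℝ)
    set v := log ((N + 1 : ℕ) : ℝ)
    have hv : 0 < v := hu.trans_le huv
    set A := ∑ p ∈ (Finset.range (N + 1)).filter Nat.Prime, log p / p
    have hlog : 1 - u / v ≤ log v - log u := by
      rw [← Real.log_div hv.ne' hu.ne']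
      have := Real.one_sub_inv_le_log_of_pos (div_pos hv hu)
      rwa [inv_div] at this
    have hinv : 0 ≤ 1 / u - 1 / v := by
      rw [sub_nonneg]; exact one_div_le_one_div_of_le hu huv
    have hkey : A / u - A / v ≤ (log v - log 4 / v) - (log u - log 4 / u) := by
      calc A / u - A / v = A * (1 / u - 1 / v) := by ring
        _ ≤ (u + log 4) * (1 / u - 1 / v) := by gcongr
        _ = (1 - u / v) + (log 4 / u - log 4 / v) := by field_simp
        _ ≤ _ := by linarith
    rw [Finset.range_add_one, Finset.filter_insert]
    split_ifs with hp
    · rw [Finset.sum_insert (by simp), Finset.sum_insert (by simp)]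
      have : (v / ((N + 1 : ℕ) : ℝ) + A) / v = 1 / ((N + 1 : ℕ) : ℝ) + A / v := by
        have : ((N + 1 : ℕ) : ℝ) ≠ 0 := by positivity
        field_simp
      change 1 / ((N + 1 : ℕ) : ℝ) + _ ≤ (v / ((N + 1 : ℕ) : ℝ) + A) / v + _ - _ + _
      rw [this]
      linarith
    · linarith

/-- Mertens' upper bound for the sum of reciprocals of primes. -/
lemma exists_sum_inv_prime_le : ∃ c : ℝ, ∀ N : ℕ, 2 ≤ N →
    ∑ p ∈ (Finset.range (N + 1)).filter Nat.Prime, 1 / (p : ℝ) ≤ log (log N) + c := by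
  refine ⟨1 + (log 4 / log 2 - log (log 2)), fun N hN => ?_⟩
  have h1 := sum_inv_prime_sub_le hN
  have h2 := sum_log_div_prime_le (N := N) (by omega)
  have hu : 0 < log (N : ℝ) := Real.log_pos (by exact_mod_cast hN)
  have h3 : (∑ p ∈ (Finset.range (N + 1)).filter Nat.Prime, log p / p) / log N
      ≤ (log N + log 4) / log N := by gcongr
  have h4 : (log N + log 4) / log (N : ℝ) = 1 + log 4 / log N := by field_simp
  linarith

lemma exists_neg_sum_inv_primeFactors_le : ∃ c : ℝ, ∀ k : ℕ, 1 ≤ k →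
    -∑ p ∈ k.primeFactors, 1 / (p : ℝ) ≤ log ((Nat.totient k : ℝ) / k) + c := by
  have hs : Summable (fun n : ℕ => 1 / (n : ℝ) ^ 2) := Real.summable_one_div_nat_pow.mpr (by norm_num)
  refine ⟨2 * ∑' n : ℕ, 1 / (n : ℝ) ^ 2, fun k hk => ?_⟩
  have hk' : (0 : ℝ) < k := by exact_mod_cast hk
  have htot : (Nat.totient k : ℝ) / k = ∏ p ∈ k.primeFactors, (1 - (p : ℝ)⁻¹) := by
    have := Nat.totient_eq_mul_prod_factors k
    have h2 : (Nat.totient k : ℝ) = k * ∏ p ∈ k.primeFactors, (1 - (p : ℝ)⁻¹) := by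
      have h3 := congrArg (fun q : ℚ => (q : ℝ)) this
      push_cast at h3
      exact h3
    rw [h2]; field_simp
  have hp : ∀ p ∈ k.primeFactors, (p : ℝ)⁻¹ ≤ 1 / 2 := by
    intro p hp
    have : (2 : ℝ) ≤ p := by exact_mod_cast (Nat.prime_of_mem_primeFactors hp).two_le
    rw [one_div]
    exact inv_anti₀ (by norm_num) this
  rw [htot, Real.log_prod (fun p h => by have := hp p h; linarith)]
  have h1 : ∑ p ∈ k.primeFactors, 1 / (p : ℝ) ^ 2 ≤ ∑' n : ℕ, 1 / (n : ℝ) ^ 2 :=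
    hs.sum_le_tsum _ (fun _ _ => by positivity)
  have h2 : ∀ p ∈ k.primeFactors, -(1 / (p : ℝ)) ≤ log (1 - (p : ℝ)⁻¹) + 2 * (1 / (p : ℝ) ^ 2) := by
    intro p h
    have ht := hp p h
    have ht0 : 0 ≤ (p : ℝ)⁻¹ := by positivity
    have e1 : 1 / (p : ℝ) ^ 2 = ((p : ℝ)⁻¹) ^ 2 := by rw [one_div, inv_pow]
    rw [e1, one_div]
    set t := (p : ℝ)⁻¹
    have hlog := Real.one_sub_inv_le_log_of_pos (x := 1 - t) (by linarith)
    have : 1 - (1 - t)⁻¹ = - t / (1 - t) := by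
      have : (1 - t) ≠ 0 := by linarith
      field_simp; ring
    rw [this] at hlog
    have : -t - 2 * t ^ 2 ≤ -t / (1 - t) := by
      rw [le_div_iff₀ (by linarith)]
      nlinarith [mul_nonneg ht0 ht0]
    linarith
  calc -∑ p ∈ k.primeFactors, 1 / (p : ℝ) = ∑ p ∈ k.primeFactors, -(1 / (p : ℝ)) := by
        rw [Finset.sum_neg_distrib]
    _ ≤ ∑ p ∈ k.primeFactors, (log (1 - (p : ℝ)⁻¹) + 2 * (1 / (p : ℝ) ^ 2)) := Finset.sum_le_sum h2
    _ ≤ _ := by rw [Finset.sum_add_distrib, ← Finset.mul_sum]; linarith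

/-- Mertens' upper bound for the sum of reciprocals of primes not dividing `k`. -/
lemma exists_sum_inv_prime_not_dvd_le : ∃ c : ℝ, 0 ≤ c ∧ ∀ (x : ℝ) (k : ℕ), 2 ≤ x → 1 ≤ k →
    (k : ℝ) ≤ x →
    ∑ p ∈ (Finset.range (⌊x⌋₊ + 1)).filter (fun p => p.Prime ∧ ¬ p ∣ k), 1 / (p : ℝ) ≤
      log ((Nat.totient k : ℝ) / k * log x) + c := by
  obtain ⟨c₁, h₁⟩ := exists_sum_inv_prime_le
  obtain ⟨c₂, h₂⟩ := exists_neg_sum_inv_primeFactors_le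
  refine ⟨max 0 (c₁ + c₂), le_max_left _ _, fun x k hx hk hkx => ?_⟩
  have hN : 2 ≤ ⌊x⌋₊ := Nat.le_floor (by exact_mod_cast hx)
  have hsplit := Finset.sum_filter_add_sum_filter_not
    ((Finset.range (⌊x⌋₊ + 1)).filter Nat.Prime) (fun p => p ∣ k) (fun p => 1 / (p : ℝ))
  rw [Finset.filter_filter, Finset.filter_filter] at hsplit
  have hset : (Finset.range (⌊x⌋₊ + 1)).filter (fun p => p.Prime ∧ p ∣ k) = k.primeFactors := by
    ext p
    simp only [Finset.mem_filter, Finset.mem_range, Nat.mem_primeFactors]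
    constructor
    · rintro ⟨_, h, h'⟩; exact ⟨h, h', by omega⟩
    · rintro ⟨h, h', _⟩
      have : k ≤ ⌊x⌋₊ := Nat.le_floor hkx
      have := Nat.le_of_dvd (by omega) h'
      exact ⟨by omega, h, h'⟩
  rw [hset] at hsplit
  have hlogN : 0 < log (⌊x⌋₊ : ℝ) := Real.log_pos (by exact_mod_cast hN)
  have hmono : log (log (⌊x⌋₊ : ℝ)) ≤ log (log x) :=
    Real.log_le_log hlogN (Real.log_le_log (by positivity) (Nat.floor_le (by linarith)))
  have htot : (0 : ℝ) < (Nat.totient k : ℝ) / k := by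
    have := Nat.totient_pos.mpr hk
    positivity
  rw [Real.log_mul htot.ne' (Real.log_pos (by linarith)).ne']
  linarith [h₁ _ hN, h₂ k hk, le_max_right 0 (c₁ + c₂)]

lemma taud_eq_card (d : ℕ) {n : ℕ} (hn : n ≠ 0) : taud d n = (Nat.finMulAntidiag d n).card :=
  Nat.subtype_card _ fun v => by simp [Nat.mem_finMulAntidiag, hn]

lemma taud_succ (d : ℕ) {n : ℕ} (hn : n ≠ 0) :
    taud (d + 1) n = ∑ m ∈ n.divisors, taud d m := by
  rw [taud_eq_card _ hn, Finset.card_eq_sum_card_fiberwise (t := n.divisors)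
    (f := fun v : Fin (d + 1) → ℕ => ∏ i : Fin d, v i.succ)]
  · refine Finset.sum_congr rfl fun m hm => ?_
    have hm0 : m ≠ 0 := (Nat.pos_of_mem_divisors hm).ne'
    rw [taud_eq_card _ hm0]
    refine Finset.card_bij' (fun v _ => Fin.tail v) (fun w _ => Fin.cons (n / m) w) ?_ ?_ ?_ ?_
    · intro v hv
      simp only [Finset.mem_filter, Nat.mem_finMulAntidiag] at hv ⊢
      exact ⟨hv.2, hm0⟩
    · intro w hw
      simp only [Finset.mem_filter, Nat.mem_finMulAntidiag, Fin.prod_univ_succ, Fin.cons_zero,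
        Fin.cons_succ] at hw ⊢
      rw [hw.1]
      exact ⟨⟨Nat.div_mul_cancel (Nat.dvd_of_mem_divisors hm), hn⟩, rfl⟩
    · intro v hv
      simp only [Finset.mem_filter, Nat.mem_finMulAntidiag, Fin.prod_univ_succ] at hv
      have : n / m = v 0 := by
        rw [← hv.1.1, hv.2, Nat.mul_div_cancel _ (Nat.pos_of_ne_zero hm0)]
      rw [this, Fin.cons_self_tail]
    · intro w _
      exact Fin.tail_cons _ _
  · intro v hv
    simp only [Finset.mem_coe, Nat.mem_finMulAntidiag, Fin.prod_univ_succ] at hv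
    exact Finset.mem_coe.mpr (Nat.mem_divisors.mpr ⟨Dvd.intro_left _ hv.1, hn⟩)

lemma taud_zero {n : ℕ} : taud 0 n = if n = 1 then 1 else 0 := by
  rw [taud]
  split_ifs with h
  · subst h; simp
  · simp [Ne.symm h]

lemma taud_mono_of_dvd (d : ℕ) {m n : ℕ} (hn : n ≠ 0) (h : m ∣ n) : taud (d + 1) m ≤ taud (d + 1) n := by
  rw [taud_succ d hn, taud_succ d (ne_zero_of_dvd_ne_zero hn h)]
  exact Finset.sum_le_sum_of_subset (Nat.divisors_subset_of_dvd hn h)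

lemma taud_mul_le (d : ℕ) {m n : ℕ} (hm : m ≠ 0) (hn : n ≠ 0) :
    taud d (m * n) ≤ taud d m * taud d n := by
  induction d generalizing m n with
  | zero =>
    simp only [taud_zero, mul_eq_one]
    split_ifs <;> simp_all
  | succ d ih =>
    rw [taud_succ d (mul_ne_zero hm hn), taud_succ d hm, taud_succ d hn, Finset.sum_mul_sum,
      ← Finset.sum_product', Nat.divisors_mul, Finset.mul_def]
    refine (Finset.sum_image_le_of_nonneg fun _ _ => Nat.zero_le _).trans ?_
    refine Finset.sum_le_sum fun e he => ?_
    rw [Finset.mem_product] at he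
    exact ih (Nat.pos_of_mem_divisors he.1).ne' (Nat.pos_of_mem_divisors he.2).ne'

lemma taud_pos (d : ℕ) {n : ℕ} (hn : n ≠ 0) : 0 < taud (d + 1) n := by
  induction d with
  | zero =>
    rw [taud_succ _ hn]
    simp [taud_zero, hn]
  | succ d ih =>
    rw [taud_succ _ hn]
    exact ih.trans_le (Finset.single_le_sum (f := fun m => taud (d + 1) m) (fun _ _ => Nat.zero_le _)
      (Nat.mem_divisors_self n hn))

lemma taud_one (d : ℕ) : taud d 1 = 1 := by
  induction d with
  | zero => simp [taud_zero]
  | succ d ih => simp [taud_succ, ih]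

lemma taud_prime (d : ℕ) {p : ℕ} (hp : p.Prime) : taud d p = d := by
  induction d with
  | zero => simp [taud_zero, hp.ne_one]
  | succ d ih => rw [taud_succ _ hp.ne_zero, hp.sum_divisors, ih, taud_one]

lemma taud_prime_pow_le (d : ℕ) {p : ℕ} (hp : p.Prime) (j : ℕ) : taud d (p ^ j) ≤ (j + 1) ^ d := by
  induction d generalizing j with
  | zero => simp only [taud_zero]; split_ifs <;> simp
  | succ d ih =>
    rw [taud_succ _ (pow_ne_zero _ hp.ne_zero), Nat.sum_divisors_prime_pow hp]
    calc _ ≤ ∑ i ∈ Finset.range (j + 1), (j + 1) ^ d := by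
          refine Finset.sum_le_sum fun i hi => (ih i).trans ?_
          have := Finset.mem_range.mp hi
          gcongr
          omega
      _ = _ := by simp [pow_succ']

lemma taud_eq_zeta_pow (d : ℕ) {n : ℕ} (hn : n ≠ 0) : taud d n = (ζ ^ d) n := by
  induction d generalizing n with
  | zero => simp [taud_zero, ArithmeticFunction.one_apply]
  | succ d ih =>
    rw [taud_succ d hn, pow_succ, ArithmeticFunction.mul_zeta_apply]
    exact Finset.sum_congr rfl fun m hm => ih (Nat.pos_of_mem_divisors hm).ne'

lemma taud_mul_of_coprime (d : ℕ) {m n : ℕ} (hm : m ≠ 0) (hn : n ≠ 0) (h : m.Coprime n) :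
    taud d (m * n) = taud d m * taud d n := by
  rw [taud_eq_zeta_pow d hm, taud_eq_zeta_pow d hn, taud_eq_zeta_pow d (mul_ne_zero hm hn)]
  exact (ArithmeticFunction.isMultiplicative_zeta.pow).map_mul_of_coprime h

lemma card_dvd_progression_le {S : Finset ℕ} {X : ℝ} {k a m : ℕ} (hk : 1 ≤ k) (hm : 1 ≤ m)
    (ha : Nat.gcd a k = 1) (hS : ∀ n ∈ S, (n : ℝ) ≤ X ∧ n % k = a % k)
    (hX : (m * k : ℝ) ≤ X) :
    ((S.filter (fun n => m ∣ n)).card : ℝ) ≤ 2 * X / k / m := by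
  have hmk : (0 : ℝ) < (m * k : ℕ) := by exact_mod_cast Nat.mul_pos hm hk
  have hX0 : 0 ≤ X := le_trans (by positivity) hX
  have hcard : (S.filter (fun n => m ∣ n)).card ≤ (Finset.range (⌊X / (m * k : ℕ)⌋₊ + 1)).card := by
    apply Finset.card_le_card_of_injOn (fun n => n / (m * k))
    · intro n hn
      have hn := Finset.mem_filter.mp hn
      simp only [Finset.coe_range, Set.mem_Iio, Nat.lt_succ_iff]
      apply Nat.le_floor
      exact Nat.cast_div_le.trans (by gcongr; exact (hS n hn.1).1)
    · intro n hn n' hn' h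
      have hn := Finset.mem_filter.mp hn
      have hn' := Finset.mem_filter.mp hn'
      have hcop : m.Coprime k := by
        have h1 : Nat.gcd n k = 1 := by
          rw [← ha, Nat.gcd_comm, Nat.gcd_rec, (hS n hn.1).2, ← Nat.gcd_rec, Nat.gcd_comm]
        exact Nat.Coprime.coprime_dvd_left hn.2 h1
      have hmod : n ≡ n' [MOD m * k] := by
        rw [← Nat.modEq_and_modEq_iff_modEq_mul hcop]
        exact ⟨((Nat.modEq_zero_iff_dvd.mpr hn.2).trans (Nat.modEq_zero_iff_dvd.mpr hn'.2).symm),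
          (hS n hn.1).2.trans (hS n' hn'.1).2.symm⟩
      have h : n / (m * k) = n' / (m * k) := h
      rw [← Nat.div_add_mod n (m * k), ← Nat.div_add_mod n' (m * k), h, hmod]
  rw [Finset.card_range] at hcard
  have h1 : (1 : ℝ) ≤ X / (m * k : ℕ) := by
    rw [le_div_iff₀ hmk]; push_cast; linarith
  calc ((S.filter (fun n => m ∣ n)).card : ℝ) ≤ ((⌊X / (m * k : ℕ)⌋₊ + 1 : ℕ) : ℝ) := by
        exact_mod_cast hcard
    _ ≤ X / (m * k : ℕ) + 1 := by
        push_cast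
        gcongr
        exact_mod_cast Nat.floor_le (a := X / (m * k : ℕ)) (by positivity)
    _ ≤ 2 * (X / (m * k : ℕ)) := by linarith
    _ = _ := by push_cast; field_simp

lemma moebius_mul_prime_pow_succ (F : ArithmeticFunction ℝ) {p : ℕ} (hp : p.Prime) (j : ℕ) :
    ((μ : ArithmeticFunction ℝ) * F) (p ^ (j + 1)) = F (p ^ (j + 1)) - F (p ^ j) := by
  have h : ∀ i, ∑ e ∈ Finset.range (i + 1), ((μ : ArithmeticFunction ℝ) * F) (p ^ e) = F (p ^ i) := by
    intro i
    rw [← Nat.sum_divisors_prime_pow hp, ← ArithmeticFunction.coe_zeta_mul_apply, ← mul_assoc,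
      ArithmeticFunction.coe_zeta_mul_coe_moebius, one_mul]
  rw [← h (j + 1), ← h j, Finset.sum_range_succ _ (j + 1)]
  ring

lemma moebius_mul_nonneg {F : ArithmeticFunction ℝ} (hF : F.IsMultiplicative)
    (hmono : ∀ p : ℕ, p.Prime → ∀ j, F (p ^ j) ≤ F (p ^ (j + 1))) (n : ℕ) :
    0 ≤ ((μ : ArithmeticFunction ℝ) * F) n := by
  have hmul : ((μ : ArithmeticFunction ℝ) * F).IsMultiplicative :=
    ArithmeticFunction.isMultiplicative_moebius.intCast.mul hF
  rcases eq_or_ne n 0 with rfl | hn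
  · simp
  rw [hmul.multiplicative_factorization _ hn]
  refine Finset.prod_nonneg fun p hp => ?_
  have hp' : p.Prime := Nat.prime_of_mem_primeFactors (by simpa using hp)
  beta_reduce
  rcases n.factorization p with _ | j
  · rw [pow_zero, hmul.map_one]; exact zero_le_one
  · rw [moebius_mul_prime_pow_succ F hp']
    linarith [hmono p hp' j]

/-- A multiplicative function that is nondecreasing along prime powers, evaluated at small
divisors of the members of an arithmetic progression, is bounded on average by an Euler product. -/
lemma sum_divisor_value_le {F : ArithmeticFunction ℝ} (hF : F.IsMultiplicative)
    (hmono : ∀ p : ℕ, p.Prime → ∀ j, F (p ^ j) ≤ F (p ^ (j + 1)))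
    (hsum : ∀ p : ℕ, p.Prime → Summable (fun j : ℕ => F (p ^ j) / (p : ℝ) ^ j))
    {s S : Finset ℕ} {B : ℕ → ℕ} {X Z : ℝ} {k a : ℕ} (hk : 1 ≤ k) (ha : Nat.gcd a k = 1)
    (hS : ∀ n ∈ S, (n : ℝ) ≤ X ∧ n % k = a % k) (hZ : Z * k ≤ X) (hX : 0 ≤ X)
    (hB : ∀ n ∈ S, B n ∣ n ∧ (B n : ℝ) ≤ Z ∧ B n ∈ Nat.factoredNumbers s) :
    ∑ n ∈ S, F (B n) ≤ 2 * X / k * ∏ p ∈ s with p.Prime,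
      ∑' j : ℕ, ((μ : ArithmeticFunction ℝ) * F) (p ^ j) / (p : ℝ) ^ j := by
  classical
  set h := (μ : ArithmeticFunction ℝ) * F with hh
  have hmul : h.IsMultiplicative := ArithmeticFunction.isMultiplicative_moebius.intCast.mul hF
  have hnn : ∀ n, 0 ≤ h n := moebius_mul_nonneg hF hmono
  have hle : ∀ p : ℕ, p.Prime → ∀ j, h (p ^ j) ≤ F (p ^ j) := by
    intro p hp j
    have hconv : F = (ζ : ArithmeticFunction ℝ) * h := by
      rw [hh, ← mul_assoc, ArithmeticFunction.coe_zeta_mul_coe_moebius, one_mul]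
    conv_rhs => rw [hconv, ArithmeticFunction.coe_zeta_mul_apply]
    exact Finset.single_le_sum (f := h) (fun _ _ => hnn _)
      (Nat.mem_divisors_self _ (pow_ne_zero _ hp.ne_zero))
  obtain ⟨hsm, hprod⟩ := EulerProduct.summable_and_hasSum_factoredNumbers_prod_filter_prime_tsum
    (f := fun n : ℕ => h n / (n : ℝ)) (by simp [hmul.map_one])
    (fun {m n} hc => by
      rw [hmul.map_mul_of_coprime hc]; push_cast; rw [mul_div_mul_comm])
    (fun {p} hp => by
      refine Summable.of_nonneg_of_le (fun _ => norm_nonneg _) (fun j => ?_) (hsum p hp)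
      rw [Real.norm_of_nonneg (div_nonneg (hnn _) (Nat.cast_nonneg _))]
      push_cast
      gcongr
      exact hle p hp j) s
  have hprod' : ∏ p ∈ s with p.Prime, ∑' j : ℕ, h (p ^ j) / (p : ℝ) ^ j =
      ∏ p ∈ s with p.Prime, ∑' j : ℕ, h (p ^ j) / ((p ^ j : ℕ) : ℝ) := by
    push_cast; rfl
  rw [hprod', ← hprod.tsum_eq]
  set T := (Finset.Icc 1 ⌊Z⌋₊).filter (fun m => m ∈ Nat.factoredNumbers s)
  have hT : ∑ m ∈ T, h m / (m : ℝ) ≤ ∑' m : Nat.factoredNumbers s, h m / ((m : ℕ) : ℝ) := by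
    rw [← Finset.sum_subtype_of_mem (p := fun m => m ∈ Nat.factoredNumbers s)
      (fun m : ℕ => h m / (m : ℝ)) (fun m hm => (Finset.mem_filter.mp hm).2)]
    exact hprod.summable.sum_le_tsum _ fun m _ => div_nonneg (hnn _) (Nat.cast_nonneg _)
  have hF_le : ∀ n ∈ S, F (B n) ≤ ∑ m ∈ T, if m ∣ n then h m else 0 := by
    intro n hn
    obtain ⟨h1, h2, h3⟩ := hB n hn
    have hconv : F = (ζ : ArithmeticFunction ℝ) * h := by
      rw [hh, ← mul_assoc, ArithmeticFunction.coe_zeta_mul_coe_moebius, one_mul]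
    conv_lhs => rw [hconv, ArithmeticFunction.coe_zeta_mul_apply]
    rw [← Finset.sum_filter]
    refine Finset.sum_le_sum_of_subset_of_nonneg (fun m hm => ?_) fun _ _ _ => hnn _
    have hmB := Nat.dvd_of_mem_divisors hm
    have hB0 : B n ≠ 0 := (Nat.mem_divisors.mp hm).2
    refine Finset.mem_filter.mpr ⟨Finset.mem_filter.mpr ⟨Finset.mem_Icc.mpr
      ⟨Nat.pos_of_mem_divisors hm, ?_⟩, Nat.mem_factoredNumbers_of_dvd h3 hmB⟩, hmB.trans h1⟩
    exact (Nat.le_of_dvd (Nat.pos_of_ne_zero hB0) hmB).trans (Nat.le_floor h2)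
  calc ∑ n ∈ S, F (B n) ≤ ∑ n ∈ S, ∑ m ∈ T, if m ∣ n then h m else 0 := Finset.sum_le_sum hF_le
    _ = ∑ m ∈ T, ((S.filter (fun n => m ∣ n)).card : ℝ) * h m := by
        rw [Finset.sum_comm]
        refine Finset.sum_congr rfl fun m _ => ?_
        rw [← Finset.sum_filter, Finset.sum_const, nsmul_eq_mul]
    _ ≤ ∑ m ∈ T, (2 * X / k / m) * h m := by
        refine Finset.sum_le_sum fun m hm => ?_
        have hm := Finset.mem_Icc.mp (Finset.mem_filter.mp hm).1
        have hmZ : (m : ℝ) ≤ Z := (Nat.le_floor_iff' (by omega)).mp hm.2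
        refine mul_le_mul_of_nonneg_right ?_ (hnn m)
        refine card_dvd_progression_le hk hm.1 ha hS (le_trans ?_ hZ)
        gcongr
    _ = 2 * X / k * ∑ m ∈ T, h m / m := by
        rw [Finset.mul_sum]
        exact Finset.sum_congr rfl fun m _ => by ring
    _ ≤ _ := by gcongr

/-- The properties of a power of a divisor function that enter its mean value estimate. -/
structure DivisorLike (f : ℕ → ℝ) (D : ℝ) : Prop where
  one_le : ∀ n, n ≠ 0 → 1 ≤ f n
  map_one : f 1 = 1
  mul_le : ∀ m n, m ≠ 0 → n ≠ 0 → f (m * n) ≤ f m * f n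
  mul_coprime : ∀ m n, m.Coprime n → f (m * n) = f m * f n
  prime : ∀ p, p.Prime → f p = D
  mono : ∀ p, p.Prime → ∀ j, f (p ^ j) ≤ f (p ^ (j + 1))

lemma divisorLike_taud (d : ℕ) {R : ℝ} (hR : 0 ≤ R) :
    DivisorLike (fun n => (taud (d + 1) n : ℝ) ^ R) (((d + 1 : ℕ) : ℝ) ^ R) where
  one_le n hn := Real.one_le_rpow (by exact_mod_cast taud_pos d hn) hR
  map_one := by simp [taud_one]
  mul_le m n hm hn := by
    rw [← Real.mul_rpow (by positivity) (by positivity)]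
    exact Real.rpow_le_rpow (by positivity) (by exact_mod_cast taud_mul_le (d + 1) hm hn) hR
  mul_coprime m n h := by
    rcases eq_or_ne m 0 with rfl | hm
    · simp only [Nat.coprime_zero_left] at h
      subst h
      simp [taud_one]
    rcases eq_or_ne n 0 with rfl | hn
    · simp only [Nat.coprime_zero_right] at h
      subst h
      simp [taud_one]
    rw [← Real.mul_rpow (by positivity) (by positivity), taud_mul_of_coprime (d + 1) hm hn h]
    push_cast
    rfl
  prime p hp := by simp only [taud_prime _ hp]
  mono p hp j := Real.rpow_le_rpow (by positivity)
    (by exact_mod_cast taud_mono_of_dvd d (pow_ne_zero _ hp.ne_zero) (pow_dvd_pow _ j.le_succ)) hR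

namespace DivisorLike

variable {f : ℕ → ℝ} {D : ℝ}

lemma one_le_D (hf : DivisorLike f D) : 1 ≤ D := by
  rw [← hf.prime 2 Nat.prime_two]; exact hf.one_le 2 (by norm_num)

lemma prime_pow_le (hf : DivisorLike f D) {p : ℕ} (hp : p.Prime) (j : ℕ) : f (p ^ j) ≤ D ^ j := by
  induction j with
  | zero => simp [hf.map_one]
  | succ j ih =>
    rw [pow_succ, pow_succ]
    refine (hf.mul_le _ _ (pow_ne_zero _ hp.ne_zero) hp.ne_zero).trans ?_
    rw [hf.prime p hp]
    have := hf.one_le_D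
    gcongr

lemma le_rpow_of_rough (hf : DivisorLike f D) {q : ℕ} (hq : 2 ≤ q) (n : ℕ) (hn : n ≠ 0)
    (hrough : ∀ p : ℕ, p.Prime → p ∣ n → q ≤ p) : f n ≤ D ^ (log n / log q) := by
  have hD := hf.one_le_D
  have hlq : 0 < log (q : ℝ) := Real.log_pos (by exact_mod_cast hq)
  induction n using induction_on_primes with
  | zero => exact absurd rfl hn
  | one => simp [hf.map_one]
  | prime_mul p a hp ih =>
    have ha : a ≠ 0 := fun h => hn (by simp [h])
    have h1 := ih ha fun p' hp' h => hrough p' hp' (h.mul_left p)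
    have h2 : (1 : ℝ) ≤ log p / log q := by
      rw [one_le_div hlq]
      exact Real.log_le_log (by positivity) (by exact_mod_cast hrough p hp (dvd_mul_right _ _))
    calc f (p * a) ≤ f p * f a := hf.mul_le _ _ hp.ne_zero ha
      _ ≤ D ^ (1 : ℝ) * D ^ (log a / log q) := by
          rw [hf.prime p hp, Real.rpow_one]; gcongr
      _ = D ^ (1 + log a / log q) := by rw [Real.rpow_add (by linarith)]
      _ ≤ _ := by
          refine Real.rpow_le_rpow_of_exponent_le hD ?_
          push_cast
          rw [Real.log_mul (by exact_mod_cast hp.ne_zero) (by exact_mod_cast ha), add_div]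
          linarith

lemma le_pow_mul_rpow (hf : DivisorLike f D) {K δ : ℝ} {y : ℕ} (hK : 1 ≤ K)
    (hsmall : ∀ p : ℕ, p.Prime → ∀ j : ℕ, f (p ^ j) ≤ K * ((p : ℝ) ^ δ) ^ j)
    (hlarge : ∀ p : ℕ, p.Prime → y < p → D ≤ (p : ℝ) ^ δ) {n : ℕ} (hn : n ≠ 0) :
    f n ≤ K ^ (y + 1) * (n : ℝ) ^ δ := by
  have hD := hf.one_le_D
  rw [Nat.multiplicative_factorization f hf.mul_coprime hf.map_one hn, Finsupp.prod]
  have hn' : (n : ℝ) ^ δ = ∏ p ∈ n.factorization.support, ((p : ℝ) ^ δ) ^ n.factorization p := by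
    conv_lhs => rw [← Nat.prod_factorization_pow_eq_self hn, Finsupp.prod]
    push_cast
    rw [← Real.finsetProd_rpow _ _ (fun p _ => by positivity)]
    refine Finset.prod_congr rfl fun p _ => ?_
    rw [← Real.rpow_natCast, ← Real.rpow_natCast, ← Real.rpow_mul (by positivity),
      ← Real.rpow_mul (by positivity), mul_comm]
  calc ∏ p ∈ n.factorization.support, f (p ^ n.factorization p)
      ≤ ∏ p ∈ n.factorization.support,
          ((if p ≤ y then K else 1) * ((p : ℝ) ^ δ) ^ n.factorization p) := by
        refine Finset.prod_le_prod (fun p hp => ?_) fun p hp => ?_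
        · have hp' : p.Prime := Nat.prime_of_mem_primeFactors (by simpa using hp)
          exact zero_le_one.trans (hf.one_le _ (pow_ne_zero _ hp'.ne_zero))
        · have hp' : p.Prime := Nat.prime_of_mem_primeFactors (by simpa using hp)
          split_ifs with h
          · exact hsmall p hp' _
          · rw [one_mul]
            refine (hf.prime_pow_le hp' _).trans ?_
            have := hlarge p hp' (not_le.mp h)
            gcongr
    _ = (∏ p ∈ n.factorization.support, (if p ≤ y then K else 1)) * (n : ℝ) ^ δ := by
        rw [Finset.prod_mul_distrib, hn']
    _ ≤ _ := by
        gcongr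
        rw [Finset.prod_ite]
        simp only [Finset.prod_const, one_pow, mul_one]
        refine pow_le_pow_right₀ hK ?_
        calc _ ≤ (Finset.range (y + 1)).card := by
              refine Finset.card_le_card fun p hp => ?_
              have := (Finset.mem_filter.mp hp).2
              simp; omega
          _ = _ := by simp

end DivisorLike

/-- Split off from `n > Z` the longest initial product of its increasingly ordered prime factors
that does not exceed `Z`. -/
lemma exists_initial_product (n : ℕ) : ∀ Z : ℝ, 1 ≤ Z → Z < n →
    ∃ B c q : ℕ, n = B * c ∧ q.Prime ∧ q ∣ c ∧ (B : ℝ) ≤ Z ∧ Z < B * q ∧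
      (∀ p : ℕ, p.Prime → p ∣ B → p ≤ q) ∧ ∀ p : ℕ, p.Prime → p ∣ c → q ≤ p := by
  induction n using Nat.strong_induction_on with
  | _ n ih =>
    intro Z hZ hZn
    have hn1 : 1 < n := by exact_mod_cast hZ.trans_lt hZn
    have hp : n.minFac.Prime := Nat.minFac_prime hn1.ne'
    obtain ⟨m, hm⟩ := n.minFac_dvd
    set r := n.minFac with hr
    have hr0 : (0 : ℝ) < r := by exact_mod_cast hp.pos
    by_cases hrZ : Z < r
    · exact ⟨1, n, r, (one_mul n).symm, hp, n.minFac_dvd, by simpa using hZ, by simpa using hrZ,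
        fun p hp' h => absurd h hp'.not_dvd_one, fun p hp' h => Nat.minFac_le_of_dvd hp'.two_le h⟩
    · have hm0 : 0 < m := Nat.pos_of_ne_zero fun h => by simp [h] at hm; omega
      have hmn : m < n := by
        rw [hm]; exact lt_mul_of_one_lt_left hm0 hp.one_lt
      obtain ⟨B, c, q, h1, h2, h3, h4, h5, h6, h7⟩ := ih m hmn (Z / r)
        ((one_le_div hr0).mpr (not_lt.mp hrZ))
        ((div_lt_iff₀ hr0).mpr (by rw [hm] at hZn; push_cast at hZn; linarith))
      refine ⟨r * B, c, q, by rw [mul_assoc, ← h1, ← hm], h2, h3, ?_, ?_, fun p hp' h => ?_, h7⟩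
      · rw [le_div_iff₀ hr0] at h4; push_cast; linarith
      · rw [div_lt_iff₀ hr0] at h5; push_cast; linarith
      · rcases hp'.dvd_mul.mp h with h | h
        · rw [(Nat.prime_dvd_prime_iff_eq hp' hp).mp h]
          refine Nat.minFac_le_of_dvd h2.two_le (h3.trans ?_)
          rw [hm, h1]
          exact (dvd_mul_left c B).mul_left r
        · exact h6 p hp' h

/-- A divisor-like function at `n` is controlled by a tilted value at a small smooth divisor. -/
lemma DivisorLike.exists_smooth_divisor {f : ℕ → ℝ} {D : ℝ} (hf : DivisorLike f D)
    {x α M E : ℝ} {N : ℕ} (hx : 2 ≤ x) (hα : 0 < α) (hM : 1 < M) (hE : 1 ≤ E)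
    (hDM : 8 * log D ≤ α * log M) (hN : 2 * x ≤ M ^ (8 * 2 ^ N))
    {n : ℕ} (hZn : x ^ (α / 2) < n) (hnx : (n : ℝ) ≤ 2 * x)
    (hfn : f n ≤ E * (n : ℝ) ^ (α / 32)) :
    ∃ i ∈ Finset.range (N + 1), ∃ B : ℕ, B ∣ n ∧ (B : ℝ) ≤ x ^ (α / 2) ∧
      (∀ p : ℕ, p.Prime → p ∣ B → (p : ℝ) ≤ M ^ (8 * 2 ^ i)) ∧
      f n ≤ E * M * (f B * (B : ℝ) ^ (1 / (8 * 2 ^ i) : ℝ)) := by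
  have hD := hf.one_le_D
  have hx0 : 0 < x := by linarith
  have hlx : 0 < log x := Real.log_pos (by linarith)
  have hlM : 0 < log M := Real.log_pos hM
  have h2x : log (2 * x) ≤ 2 * log x := by
    rw [Real.log_mul (by norm_num) hx0.ne']
    linarith [Real.log_le_log (by norm_num) hx]
  obtain ⟨B, c, q, h1, h2, h3, h4, h5, h6, h7⟩ := exists_initial_product n (x ^ (α / 2))
    (Real.one_le_rpow (by linarith) (by positivity)) hZn
  have hn0 : n ≠ 0 := by rintro rfl; simp at hZn; linarith [Real.rpow_pos_of_pos hx0 (α / 2)]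
  have hB0 : B ≠ 0 := by rintro rfl; simp at h1; exact hn0 h1
  have hc0 : c ≠ 0 := by rintro rfl; simp at h1; exact hn0 h1
  have hB1 : (1 : ℝ) ≤ B := by exact_mod_cast Nat.pos_of_ne_zero hB0
  have hq0 : (0 : ℝ) < q := by exact_mod_cast h2.pos
  have hlq : 0 < log (q : ℝ) := Real.log_pos (by exact_mod_cast h2.one_lt)
  have hfB := hf.one_le B hB0
  have hqn : (q : ℝ) ≤ 2 * x := by
    refine le_trans ?_ hnx
    exact_mod_cast Nat.le_of_dvd (Nat.pos_of_ne_zero hn0) (h1 ▸ h3.mul_left B)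
  have hex : ∃ i, (q : ℝ) ≤ M ^ (8 * 2 ^ i) := ⟨N, hqn.trans hN⟩
  classical
  -- the tilt recovers a power of `x`
  have htilt : ∀ i : ℕ, (q : ℝ) ≤ M ^ (8 * 2 ^ i) →
      x ^ (α / 2 * (1 / (8 * 2 ^ i))) ≤ M * (B : ℝ) ^ (1 / (8 * 2 ^ i) : ℝ) := by
    intro i hi
    have hs : (0 : ℝ) ≤ 1 / (8 * 2 ^ i) := by positivity
    have hqM : (q : ℝ) ^ (1 / (8 * 2 ^ i) : ℝ) ≤ M := by
      calc (q : ℝ) ^ (1 / (8 * 2 ^ i) : ℝ) ≤ (M ^ (8 * 2 ^ i)) ^ (1 / (8 * 2 ^ i) : ℝ) :=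
            Real.rpow_le_rpow hq0.le hi hs
        _ = M := by
            rw [← Real.rpow_natCast, ← Real.rpow_mul (by linarith)]
            push_cast
            rw [mul_one_div_cancel (by positivity), Real.rpow_one]
    calc x ^ (α / 2 * (1 / (8 * 2 ^ i))) = (x ^ (α / 2)) ^ (1 / (8 * 2 ^ i) : ℝ) := by
          rw [Real.rpow_mul hx0.le]
      _ ≤ ((B : ℝ) * q) ^ (1 / (8 * 2 ^ i) : ℝ) := Real.rpow_le_rpow (by positivity) h5.le hs
      _ = (B : ℝ) ^ (1 / (8 * 2 ^ i) : ℝ) * (q : ℝ) ^ (1 / (8 * 2 ^ i) : ℝ) :=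
          Real.mul_rpow (by positivity) hq0.le
      _ ≤ (B : ℝ) ^ (1 / (8 * 2 ^ i) : ℝ) * M := by gcongr
      _ = _ := mul_comm _ _
  set i := Nat.find hex with hi
  have hqi : (q : ℝ) ≤ M ^ (8 * 2 ^ i) := Nat.find_spec hex
  refine ⟨i, Finset.mem_range.mpr (Nat.lt_succ_of_le (Nat.find_min' hex (hqn.trans hN))), B,
    ⟨c, h1⟩, h4, fun p hp h => ?_, ?_⟩
  · exact le_trans (by exact_mod_cast h6 p hp h) hqi
  have ht := htilt i hqi
  rcases Nat.eq_zero_or_pos i with h0 | hpos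
  · rw [h0] at ht ⊢
    have hnx' : (n : ℝ) ^ (α / 32) ≤ x ^ (α / 2 * (1 / (8 * 2 ^ 0))) := by
      calc (n : ℝ) ^ (α / 32) ≤ (x ^ (2 : ℝ)) ^ (α / 32) := by
            refine Real.rpow_le_rpow (by positivity) (hnx.trans ?_) (by positivity)
            rw [Real.rpow_two]; nlinarith
        _ = _ := by
            rw [← Real.rpow_mul hx0.le]; congr 1; ring
    have hpos' : 0 ≤ M * (B : ℝ) ^ (1 / (8 * 2 ^ 0) : ℝ) := by positivity
    calc f n ≤ E * (n : ℝ) ^ (α / 32) := hfn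
      _ ≤ E * (M * (B : ℝ) ^ (1 / (8 * 2 ^ 0) : ℝ)) := by gcongr; exact hnx'.trans ht
      _ ≤ E * (f B * (M * (B : ℝ) ^ (1 / (8 * 2 ^ 0) : ℝ))) := by
          exact mul_le_mul_of_nonneg_left (le_mul_of_one_le_left hpos' hfB) (by linarith)
      _ = _ := by ring
  · have hprev : M ^ (8 * 2 ^ (i - 1)) < q := not_le.mp (Nat.find_min hex (by omega))
    have hlogq : 4 * 2 ^ i * log M ≤ log q := by
      have := Real.log_le_log (by positivity) hprev.le
      rw [Real.log_pow] at this
      obtain ⟨j, hj⟩ : ∃ j, i = j + 1 := ⟨i - 1, by omega⟩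
      rw [hj] at this ⊢
      simp only [Nat.add_sub_cancel] at this
      push_cast at this
      rw [pow_succ]
      linarith
    have hfc : f c ≤ x ^ (α / 2 * (1 / (8 * 2 ^ i))) := by
      refine (hf.le_rpow_of_rough h2.two_le c hc0 h7).trans ?_
      have hlc : log (c : ℝ) ≤ 2 * log x := by
        refine (Real.log_le_log (by positivity) ?_).trans h2x
        refine le_trans ?_ hnx
        exact_mod_cast Nat.le_of_dvd (Nat.pos_of_ne_zero hn0) (h1 ▸ dvd_mul_left c B)
      rw [Real.rpow_def_of_pos (by linarith), Real.rpow_def_of_pos hx0]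
      refine Real.exp_le_exp.mpr ?_
      have hlD : 0 ≤ log D := Real.log_nonneg hD
      calc log D * (log c / log q) ≤ log D * (2 * log x / (4 * 2 ^ i * log M)) := by gcongr
        _ = (8 * log D) * (log x / (16 * 2 ^ i * log M)) := by field_simp; ring
        _ ≤ (α * log M) * (log x / (16 * 2 ^ i * log M)) := by gcongr
        _ = log x * (α / 2 * (1 / (8 * 2 ^ i))) := by field_simp; ring
    have hfB0 : 0 ≤ f B := by linarith
    have hMB : 0 ≤ f B * (M * (B : ℝ) ^ (1 / (8 * 2 ^ i) : ℝ)) := by positivity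
    calc f n ≤ f B * f c := by rw [h1]; exact hf.mul_le _ _ hB0 hc0
      _ ≤ f B * (M * (B : ℝ) ^ (1 / (8 * 2 ^ i) : ℝ)) := by gcongr; exact hfc.trans ht
      _ ≤ E * (f B * (M * (B : ℝ) ^ (1 / (8 * 2 ^ i) : ℝ))) := le_mul_of_one_le_left hMB hE
      _ = _ := by ring

/-- The arithmetic function `n ↦ f n * n ^ σ`. -/
def tilt (f : ℕ → ℝ) (σ : ℝ) : ArithmeticFunction ℝ where
  toFun n := if n = 0 then 0 else f n * (n : ℝ) ^ σ
  map_zero' := if_pos rfl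

lemma tilt_apply (f : ℕ → ℝ) (σ : ℝ) {n : ℕ} (hn : n ≠ 0) : tilt f σ n = f n * (n : ℝ) ^ σ :=
  if_neg hn

lemma tilt_prime_pow (f : ℕ → ℝ) (σ : ℝ) {p : ℕ} (hp : p.Prime) (j : ℕ) :
    tilt f σ (p ^ j) = f (p ^ j) * ((p : ℝ) ^ σ) ^ j := by
  rw [tilt_apply f σ (pow_ne_zero _ hp.ne_zero)]
  push_cast
  rw [← Real.rpow_natCast, ← Real.rpow_natCast, ← Real.rpow_mul (by positivity),
    ← Real.rpow_mul (by positivity), mul_comm σ]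

namespace DivisorLike

variable {f : ℕ → ℝ} {D : ℝ}

lemma tilt_isMultiplicative (hf : DivisorLike f D) (σ : ℝ) : (tilt f σ).IsMultiplicative := by
  rw [ArithmeticFunction.IsMultiplicative.iff_ne_zero]
  refine ⟨by simp [tilt_apply, hf.map_one], fun {m n} hm hn h => ?_⟩
  rw [tilt_apply _ _ hm, tilt_apply _ _ hn, tilt_apply _ _ (mul_ne_zero hm hn),
    hf.mul_coprime m n h]
  push_cast
  rw [Real.mul_rpow (by positivity) (by positivity)]
  ring

lemma tilt_mono (hf : DivisorLike f D) {σ : ℝ} (hσ : 0 ≤ σ) (p : ℕ) (hp : p.Prime) (j : ℕ) :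
    tilt f σ (p ^ j) ≤ tilt f σ (p ^ (j + 1)) := by
  rw [tilt_prime_pow f σ hp, tilt_prime_pow f σ hp]
  have h1 : (1 : ℝ) ≤ (p : ℝ) ^ σ := Real.one_le_rpow (by exact_mod_cast hp.one_le) hσ
  have h2 := hf.mono p hp j
  have h3 := hf.one_le (p ^ (j + 1)) (pow_ne_zero _ hp.ne_zero)
  gcongr
  omega

lemma tilt_div_le {σ c : ℝ} (hσ : σ ≤ 1 / 8) {p : ℕ} (hp : p.Prime) {j : ℕ}
    (hc : f (p ^ j) ≤ c * ((p : ℝ) ^ (1 / 8 : ℝ)) ^ j) (hc0 : 0 ≤ c) :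
    tilt f σ (p ^ j) / (p : ℝ) ^ j ≤ c * ((p : ℝ) ^ (-(3 / 4) : ℝ)) ^ j := by
  have hp1 : (1 : ℝ) ≤ p := by exact_mod_cast hp.one_le
  have hp0 : (0 : ℝ) < p := by linarith
  rw [tilt_prime_pow f σ hp, div_le_iff₀ (by positivity)]
  calc f (p ^ j) * ((p : ℝ) ^ σ) ^ j
      ≤ (c * ((p : ℝ) ^ (1 / 8 : ℝ)) ^ j) * ((p : ℝ) ^ (1 / 8 : ℝ)) ^ j := by
        gcongr
    _ = c * ((p : ℝ) ^ (1 / 4 : ℝ)) ^ j := by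
        rw [mul_assoc, ← mul_pow, ← Real.rpow_add hp0]; norm_num
    _ = _ := by
        rw [mul_assoc, ← mul_pow]
        congr 2
        nth_rewrite 3 [← Real.rpow_one (p : ℝ)]
        rw [← Real.rpow_add hp0]; norm_num

lemma rpow_neg_three_quarters_le {p : ℕ} (hp : p.Prime) : (p : ℝ) ^ (-(3 / 4) : ℝ) ≤ 3 / 5 := by
  have h2 : (2 : ℝ) ≤ p := by exact_mod_cast hp.two_le
  calc (p : ℝ) ^ (-(3 / 4) : ℝ) ≤ (2 : ℝ) ^ (-(3 / 4) : ℝ) :=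
        Real.rpow_le_rpow_of_nonpos (by norm_num) h2 (by norm_num)
    _ ≤ 3 / 5 := by
        refine le_of_pow_le_pow_left₀ (n := 4) (by norm_num) (by norm_num) ?_
        rw [← Real.rpow_natCast, ← Real.rpow_mul (by norm_num)]
        norm_num

lemma geometric_facts {p : ℕ} (hp : p.Prime) :
    Summable (fun j : ℕ => ((p : ℝ) ^ (-(3 / 4) : ℝ)) ^ j) ∧
      ∑' j : ℕ, ((p : ℝ) ^ (-(3 / 4) : ℝ)) ^ j ≤ 3 := by
  have h0 : (0 : ℝ) ≤ (p : ℝ) ^ (-(3 / 4) : ℝ) := by positivity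
  have h1 := rpow_neg_three_quarters_le hp
  refine ⟨summable_geometric_of_lt_one h0 (by linarith), ?_⟩
  rw [tsum_geometric_of_lt_one h0 (by linarith), inv_le_comm₀ (by linarith) (by norm_num)]
  linarith

lemma summable_tilt (hf : DivisorLike f D) {K σ : ℝ} (hK : 1 ≤ K) (hσ : σ ≤ 1 / 8)
    (hsmall : ∀ p : ℕ, p.Prime → ∀ j : ℕ, f (p ^ j) ≤ K * ((p : ℝ) ^ (1 / 8 : ℝ)) ^ j)
    (p : ℕ) (hp : p.Prime) : Summable (fun j : ℕ => tilt f σ (p ^ j) / (p : ℝ) ^ j) := by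
  refine Summable.of_nonneg_of_le (fun j => ?_)
    (fun j => tilt_div_le hσ hp (hsmall p hp j) (by linarith)) ((geometric_facts hp).1.mul_left K)
  have := hf.one_le _ (pow_ne_zero j hp.ne_zero)
  rw [tilt_prime_pow f σ hp]
  positivity

lemma moebius_tilt_le (hf : DivisorLike f D) (σ : ℝ) {p : ℕ} (hp : p.Prime) (j : ℕ) :
    ((μ : ArithmeticFunction ℝ) * tilt f σ) (p ^ j) ≤ tilt f σ (p ^ j) := by
  rcases j with _ | j
  · simp
  · rw [moebius_mul_prime_pow_succ _ hp, sub_le_self_iff, tilt_prime_pow f σ hp]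
    have := hf.one_le _ (pow_ne_zero j hp.ne_zero)
    positivity

lemma eulerFactor_le (hf : DivisorLike f D) {K σ M : ℝ} {y : ℕ} (hK : 1 ≤ K) (hσ0 : 0 ≤ σ)
    (hσ : σ ≤ 1 / 8)
    (hsmall : ∀ p : ℕ, p.Prime → ∀ j : ℕ, f (p ^ j) ≤ K * ((p : ℝ) ^ (1 / 8 : ℝ)) ^ j)
    (hlarge : ∀ p : ℕ, p.Prime → y < p → D ≤ (p : ℝ) ^ (1 / 8 : ℝ))
    {p : ℕ} (hp : p.Prime) (hpM : (p : ℝ) ^ σ ≤ M) :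
    ∑' j : ℕ, ((μ : ArithmeticFunction ℝ) * tilt f σ) (p ^ j) / (p : ℝ) ^ j ≤
      (if p ≤ y then 3 * K else 1) *
        exp ((D - 1) * (1 / p) + D * M * σ * (log p / p) + 3 * (1 / (p : ℝ) ^ (3 / 2 : ℝ))) := by
  have hD := hf.one_le_D
  have hp1 : (1 : ℝ) ≤ p := by exact_mod_cast hp.one_le
  have hp0 : (0 : ℝ) < p := by linarith
  have hlp : 0 ≤ log (p : ℝ) := Real.log_nonneg hp1
  have hM : 0 ≤ M := le_trans (by positivity) hpM
  have hsumF := hf.summable_tilt hK hσ hsmall p hp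
  set h := (μ : ArithmeticFunction ℝ) * tilt f σ with hh
  have hnn : ∀ j, 0 ≤ h (p ^ j) / (p : ℝ) ^ j := fun j =>
    div_nonneg (moebius_mul_nonneg (hf.tilt_isMultiplicative σ) (hf.tilt_mono hσ0) _) (by positivity)
  have hle : ∀ j, h (p ^ j) / (p : ℝ) ^ j ≤ tilt f σ (p ^ j) / (p : ℝ) ^ j := fun j => by
    have := hf.moebius_tilt_le σ hp j
    gcongr
  have hsum := Summable.of_nonneg_of_le hnn hle hsumF
  obtain ⟨hgs, hg3⟩ := geometric_facts hp
  have hexp : 0 ≤ (D - 1) * (1 / p) + D * M * σ * (log p / p) +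
      3 * (1 / (p : ℝ) ^ (3 / 2 : ℝ)) := by
    have : 0 ≤ D - 1 := by linarith
    positivity
  split_ifs with hy
  · calc ∑' j : ℕ, h (p ^ j) / (p : ℝ) ^ j ≤ ∑' j : ℕ, K * ((p : ℝ) ^ (-(3 / 4) : ℝ)) ^ j :=
          hsum.tsum_le_tsum (fun j => (hle j).trans
            (tilt_div_le hσ hp (hsmall p hp j) (by linarith))) (hgs.mul_left K)
      _ = K * ∑' j : ℕ, ((p : ℝ) ^ (-(3 / 4) : ℝ)) ^ j := tsum_mul_left
      _ ≤ K * 3 := by gcongr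
      _ = 3 * K * 1 := by ring
      _ ≤ _ := by gcongr; exact Real.one_le_exp hexp
  · rw [one_mul]
    have hDp := hlarge p hp (not_le.mp hy)
    have htail : ∑' j : ℕ, h (p ^ (j + 2)) / (p : ℝ) ^ (j + 2) ≤
        3 * (1 / (p : ℝ) ^ (3 / 2 : ℝ)) := by
      have hsq : ((p : ℝ) ^ (-(3 / 4) : ℝ)) ^ 2 = 1 / (p : ℝ) ^ (3 / 2 : ℝ) := by
        rw [← Real.rpow_natCast, ← Real.rpow_mul hp0.le, one_div, ← Real.rpow_neg hp0.le]
        norm_num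
      calc ∑' j : ℕ, h (p ^ (j + 2)) / (p : ℝ) ^ (j + 2)
          ≤ ∑' j : ℕ, ((p : ℝ) ^ (-(3 / 4) : ℝ)) ^ 2 * ((p : ℝ) ^ (-(3 / 4) : ℝ)) ^ j := by
            refine ((summable_nat_add_iff 2).mpr hsum).tsum_le_tsum (fun j => ?_)
              (hgs.mul_left _)
            refine (hle _).trans ((tilt_div_le (c := 1) hσ hp ?_ zero_le_one).trans_eq ?_)
            · rw [one_mul]
              refine (hf.prime_pow_le hp _).trans ?_
              gcongr
            · rw [one_mul, pow_add, mul_comm]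
        _ = ((p : ℝ) ^ (-(3 / 4) : ℝ)) ^ 2 * ∑' j : ℕ, ((p : ℝ) ^ (-(3 / 4) : ℝ)) ^ j :=
            tsum_mul_left
        _ ≤ 1 / (p : ℝ) ^ (3 / 2 : ℝ) * 3 := by rw [hsq]; gcongr
        _ = _ := mul_comm _ _
    have hone : h (p ^ 1) / (p : ℝ) ^ 1 ≤ (D - 1) * (1 / p) + D * M * σ * (log p / p) := by
      have e1 := moebius_mul_prime_pow_succ (tilt f σ) hp 0
      rw [zero_add, ← hh, tilt_prime_pow f σ hp, tilt_prime_pow f σ hp, pow_zero, pow_zero, pow_one,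
        pow_one, hf.prime p hp, hf.map_one, one_mul] at e1
      rw [pow_one, pow_one, e1]
      have e2 : (p : ℝ) ^ σ - 1 ≤ M * (σ * log p) := by
        have hpσ : (p : ℝ) ^ σ = exp (σ * log p) := by
          rw [Real.rpow_def_of_pos hp0, mul_comm]
        rw [hpσ] at hpM ⊢
        have hu : 0 ≤ σ * log p := by positivity
        have e3 := Real.add_one_le_exp (-(σ * log p))
        have e4 : exp (σ * log p) * exp (-(σ * log p)) = 1 := by
          rw [← Real.exp_add]; simp
        calc exp (σ * log p) - 1 = exp (σ * log p) * (1 - exp (-(σ * log p))) := by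
              rw [mul_sub, e4, mul_one]
          _ ≤ exp (σ * log p) * (σ * log p) := by gcongr; linarith
          _ ≤ _ := by gcongr
      calc (D * (p : ℝ) ^ σ - 1) / p = ((D - 1) + D * ((p : ℝ) ^ σ - 1)) / p := by ring
        _ ≤ ((D - 1) + D * (M * (σ * log p))) / p := by gcongr
        _ = _ := by ring
    have hzero : h (p ^ 0) / (p : ℝ) ^ 0 = 1 := by
      rw [pow_zero, pow_zero, div_one, hh, ArithmeticFunction.mul_apply_one,
        (hf.tilt_isMultiplicative σ).map_one]
      simp
    rw [← hsum.sum_add_tsum_nat_add 2, Finset.sum_range_succ, Finset.sum_range_one, hzero]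
    refine le_trans ?_ (Real.add_one_le_exp _)
    linarith

end DivisorLike

namespace DivisorLike

variable {f : ℕ → ℝ} {D : ℝ}

lemma prod_eulerFactor_le (hf : DivisorLike f D) {K σ M Q T : ℝ} {y : ℕ} (hK : 1 ≤ K)
    (hσ0 : 0 < σ) (hσ : σ ≤ 1 / 8) (hM : 1 ≤ M) (hQ : 1 ≤ Q) (hQM : Q ^ σ = M)
    (hsmall : ∀ p : ℕ, p.Prime → ∀ j : ℕ, f (p ^ j) ≤ K * ((p : ℝ) ^ (1 / 8 : ℝ)) ^ j)
    (hlarge : ∀ p : ℕ, p.Prime → y < p → D ≤ (p : ℝ) ^ (1 / 8 : ℝ))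
    {s : Finset ℕ} (hs : ∀ p ∈ s, p.Prime ∧ (p : ℝ) ≤ Q) (hT : ∑ p ∈ s, 1 / (p : ℝ) ≤ T) :
    ∏ p ∈ s, ∑' j : ℕ, ((μ : ArithmeticFunction ℝ) * tilt f σ) (p ^ j) / (p : ℝ) ^ j ≤
      (3 * K) ^ (y + 1) * exp ((D - 1) * T + D * M * (log M + log 4) +
        3 * ∑' n : ℕ, 1 / (n : ℝ) ^ (3 / 2 : ℝ)) := by
  have hD := hf.one_le_D
  have hlogM : σ * log Q = log M := by rw [← hQM, Real.log_rpow (by linarith)]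
  have hfac : ∀ p ∈ s, 0 ≤ ∑' j : ℕ,
      ((μ : ArithmeticFunction ℝ) * tilt f σ) (p ^ j) / (p : ℝ) ^ j := fun p hp =>
    tsum_nonneg fun j => div_nonneg
      (moebius_mul_nonneg (hf.tilt_isMultiplicative σ) (hf.tilt_mono hσ0.le) _) (by positivity)
  refine (Finset.prod_le_prod hfac fun p hp => hf.eulerFactor_le hK hσ0.le hσ hsmall hlarge
    (hs p hp).1 ((Real.rpow_le_rpow (by positivity) (hs p hp).2 hσ0.le).trans_eq hQM)).trans ?_
  rw [Finset.prod_mul_distrib, ← Real.exp_sum]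
  have h3K : (1 : ℝ) ≤ 3 * K := by linarith
  gcongr ?_ * exp ?_
  · rw [Finset.prod_ite, Finset.prod_const, Finset.prod_const_one, mul_one]
    refine pow_le_pow_right₀ h3K ?_
    calc _ ≤ (Finset.range (y + 1)).card := by
          refine Finset.card_le_card fun p hp => ?_
          simp only [Finset.mem_filter, Finset.mem_range] at hp ⊢
          omega
      _ = y + 1 := Finset.card_range _
  · rw [Finset.sum_add_distrib, Finset.sum_add_distrib, ← Finset.mul_sum, ← Finset.mul_sum,
      ← Finset.mul_sum]
    have h1 : 0 ≤ D - 1 := by linarith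
    have hlog : ∑ p ∈ s, log p / (p : ℝ) ≤ log Q + log 4 := by
      have hQ1 : 1 ≤ ⌊Q⌋₊ := Nat.le_floor (by simpa using hQ)
      calc ∑ p ∈ s, log p / (p : ℝ)
          ≤ ∑ p ∈ (Finset.range (⌊Q⌋₊ + 1)).filter Nat.Prime, log p / (p : ℝ) := by
            refine Finset.sum_le_sum_of_subset_of_nonneg (fun p hp => ?_) fun p _ _ => by positivity
            rw [Finset.mem_filter, Finset.mem_range]
            exact ⟨Nat.lt_succ_of_le (Nat.le_floor (hs p hp).2), (hs p hp).1⟩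
        _ ≤ log ⌊Q⌋₊ + log 4 := sum_log_div_prime_le hQ1
        _ ≤ _ := by
            gcongr
            exact Nat.floor_le (by linarith)
    have hl4 : 0 ≤ log (4 : ℝ) := Real.log_nonneg (by norm_num)
    have hmid : D * M * σ * ∑ p ∈ s, log p / (p : ℝ) ≤ D * M * (log M + log 4) := by
      calc D * M * σ * ∑ p ∈ s, log p / (p : ℝ) ≤ D * M * σ * (log Q + log 4) := by gcongr
        _ = D * M * (σ * log Q + σ * log 4) := by ring
        _ ≤ D * M * (log M + 1 * log 4) := by
            rw [hlogM]
            gcongr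
            linarith
        _ = _ := by rw [one_mul]
    have hlast : ∑ p ∈ s, 1 / (p : ℝ) ^ (3 / 2 : ℝ) ≤ ∑' n : ℕ, 1 / (n : ℝ) ^ (3 / 2 : ℝ) :=
      (Real.summable_one_div_nat_rpow.mpr (by norm_num)).sum_le_tsum s fun n _ => by positivity
    gcongr

lemma sum_progression_le (hf : DivisorLike f D) {K M E T x α : ℝ} {y N k a : ℕ} {S : Finset ℕ}
    (hx : 2 ≤ x) (hα : 0 < α) (hα1 : α ≤ 1) (hK : 1 ≤ K) (hM : 1 < M) (hE : 1 ≤ E)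
    (hDM : 8 * log D ≤ α * log M) (hN : 2 * x ≤ M ^ (8 * 2 ^ N))
    (hsmall : ∀ p : ℕ, p.Prime → ∀ j : ℕ, f (p ^ j) ≤ K * ((p : ℝ) ^ (1 / 8 : ℝ)) ^ j)
    (hlarge : ∀ p : ℕ, p.Prime → y < p → D ≤ (p : ℝ) ^ (1 / 8 : ℝ))
    (hfE : ∀ n : ℕ, n ≠ 0 → f n ≤ E * (n : ℝ) ^ (α / 32))
    (hk : 1 ≤ k) (hkx : x ^ (α / 2) * k ≤ 2 * x) (ha : Nat.gcd a k = 1)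
    (hS : ∀ n ∈ S, x ≤ n ∧ (n : ℝ) ≤ 2 * x ∧ n % k = a % k)
    (hT : ∑ p ∈ (Finset.range (⌊x⌋₊ + 1)).filter (fun p => p.Prime ∧ ¬ p ∣ k), 1 / (p : ℝ) ≤ T) :
    ∑ n ∈ S, f n ≤ (N + 1) * (E * M) * (2 * (2 * x) / k *
      ((3 * K) ^ (y + 1) * exp ((D - 1) * T + D * M * (log M + log 4) +
        3 * ∑' n : ℕ, 1 / (n : ℝ) ^ (3 / 2 : ℝ)))) := by
  classical
  have hZx : x ^ (α / 2) < x := by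
    calc x ^ (α / 2) < x ^ (1 : ℝ) := Real.rpow_lt_rpow_of_exponent_lt (by linarith) (by linarith)
      _ = x := Real.rpow_one x
  have key : ∀ n : ℕ, ∃ i B : ℕ, n ∈ S → i ∈ Finset.range (N + 1) ∧ B ∣ n ∧
      (B : ℝ) ≤ x ^ (α / 2) ∧ (∀ p : ℕ, p.Prime → p ∣ B → (p : ℝ) ≤ M ^ (8 * 2 ^ i)) ∧
      f n ≤ E * M * (f B * (B : ℝ) ^ (1 / (8 * 2 ^ i) : ℝ)) := by
    intro n
    by_cases hn : n ∈ S
    · obtain ⟨h1, h2, -⟩ := hS n hn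
      have hn0 : n ≠ 0 := by
        rintro rfl
        rw [Nat.cast_zero] at h1
        linarith
      obtain ⟨i, hi, B, hB⟩ := hf.exists_smooth_divisor hx hα hM hE hDM hN
        (hZx.trans_le h1) h2 (hfE n hn0)
      exact ⟨i, B, fun _ => ⟨hi, hB⟩⟩
    · exact ⟨0, 0, fun h => absurd h hn⟩
  choose i B hiB using key
  have hEM : 0 ≤ E * M := by positivity
  have hn0 : ∀ n ∈ S, n ≠ 0 := by
    rintro n hn rfl
    have := (hS _ hn).1
    rw [Nat.cast_zero] at this
    linarith
  have hclass : ∀ j ∈ Finset.range (N + 1), ∑ n ∈ S with i n = j, f n ≤ (E * M) *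
      (2 * (2 * x) / k * ((3 * K) ^ (y + 1) * exp ((D - 1) * T + D * M * (log M + log 4) +
        3 * ∑' n : ℕ, 1 / (n : ℝ) ^ (3 / 2 : ℝ)))) := by
    intro j _
    set σ : ℝ := 1 / (8 * 2 ^ j) with hσdef
    have h2j : (1 : ℝ) ≤ 2 ^ j := one_le_pow₀ (by norm_num)
    have hσ0 : 0 < σ := by positivity
    have hσ : σ ≤ 1 / 8 := one_div_le_one_div_of_le (by norm_num) (by linarith)
    set Q : ℝ := M ^ (8 * 2 ^ j) with hQ
    have hQM : Q ^ σ = M := by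
      rw [hQ, ← Real.rpow_natCast, ← Real.rpow_mul (by linarith), hσdef]
      push_cast
      rw [mul_one_div_cancel (by positivity), Real.rpow_one]
    have hQ1 : 1 ≤ Q := one_le_pow₀ hM.le
    set s := (Finset.range (⌊x⌋₊ + 1)).filter
      (fun p : ℕ => (p.Prime ∧ ¬ p ∣ k) ∧ (p : ℝ) ≤ Q) with hs
    have hsp : s.filter Nat.Prime = s :=
      Finset.filter_true_of_mem fun p hp => (Finset.mem_filter.mp hp).2.1.1
    have hdata : ∀ n ∈ S.filter (fun n => i n = j), B n ∣ n ∧ (B n : ℝ) ≤ x ^ (α / 2) ∧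
        B n ∈ Nat.factoredNumbers s := by
      intro n hn
      obtain ⟨hnS, hij⟩ := Finset.mem_filter.mp hn
      obtain ⟨-, hBn, hBZ, hBp, -⟩ := hiB n hnS
      have hB0 : B n ≠ 0 := fun h => hn0 n hnS (by rw [h, zero_dvd_iff] at hBn; exact hBn)
      refine ⟨hBn, hBZ, Nat.mem_factoredNumbers.mpr ⟨hB0, fun p hp => ?_⟩⟩
      have hpp := Nat.prime_of_mem_primeFactorsList hp
      have hpB := Nat.dvd_of_mem_primeFactorsList hp
      rw [hs, Finset.mem_filter, Finset.mem_range]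
      refine ⟨Nat.lt_succ_of_le (Nat.le_floor ?_), ⟨hpp, fun hpk => ?_⟩, ?_⟩
      · exact (Nat.cast_le.mpr (Nat.le_of_dvd (Nat.pos_of_ne_zero hB0) hpB)).trans
          (hBZ.trans hZx.le)
      · have hmod : n ≡ a [MOD k] := (hS n hnS).2.2
        have hpa : p ∣ a := ((hmod.dvd_iff hpk).mp (hpB.trans hBn))
        have : p ∣ Nat.gcd a k := Nat.dvd_gcd hpa hpk
        rw [ha] at this
        exact hpp.one_lt.ne' (Nat.dvd_one.mp this)
      · rw [hQ, ← hij]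
        exact hBp p hpp hpB
    calc ∑ n ∈ S with i n = j, f n
        ≤ ∑ n ∈ S with i n = j, E * M * tilt f σ (B n) := by
          refine Finset.sum_le_sum fun n hn => ?_
          obtain ⟨hnS, hij⟩ := Finset.mem_filter.mp hn
          obtain ⟨-, hBn, -, -, hle⟩ := hiB n hnS
          have hB0 : B n ≠ 0 := fun h => hn0 n hnS (by rw [h, zero_dvd_iff] at hBn; exact hBn)
          rw [tilt_apply f σ hB0, hσdef, ← hij]
          exact hle
      _ = E * M * ∑ n ∈ S with i n = j, tilt f σ (B n) := by rw [Finset.mul_sum]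
      _ ≤ E * M * (2 * (2 * x) / k * ∏ p ∈ s with p.Prime,
            ∑' j : ℕ, ((μ : ArithmeticFunction ℝ) * tilt f σ) (p ^ j) / (p : ℝ) ^ j) := by
          gcongr
          exact sum_divisor_value_le (hf.tilt_isMultiplicative σ) (hf.tilt_mono hσ0.le)
            (hf.summable_tilt hK hσ hsmall) hk ha
            (fun n hn => (hS n (Finset.mem_filter.mp hn).1).2) hkx (by linarith) hdata
      _ ≤ _ := by
          rw [hsp]
          gcongr
          refine hf.prod_eulerFactor_le hK hσ0 hσ hM.le hQ1 hQM hsmall hlarge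
            (fun p hp => ⟨(Finset.mem_filter.mp hp).2.1.1, (Finset.mem_filter.mp hp).2.2⟩)
            (le_trans ?_ hT)
          refine Finset.sum_le_sum_of_subset_of_nonneg (fun p hp => ?_) fun p _ _ => by positivity
          obtain ⟨h1, h2⟩ := Finset.mem_filter.mp hp
          exact Finset.mem_filter.mpr ⟨h1, h2.1⟩
  rw [← Finset.sum_fiberwise_of_maps_to (g := i) (t := Finset.range (N + 1))
    fun n hn => (hiB n hn).1]
  refine (Finset.sum_le_sum hclass).trans_eq ?_
  rw [Finset.sum_const, Finset.card_range, nsmul_eq_mul]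
  push_cast
  ring

end DivisorLike

lemma taud_rpow_prime_pow_le (d : ℕ) {A R δ : ℝ} (hA : 0 < A) (hR : 0 ≤ R) (hRA : d * R ≤ A)
    (hδ : 0 < δ) (hδ1 : δ ≤ 1) {p : ℕ} (hp : p.Prime) (j : ℕ) :
    (taud d (p ^ j) : ℝ) ^ R ≤ 2 * (A / (δ * log 2)) ^ A * ((p : ℝ) ^ δ) ^ j := by
  have hl2 : 0 < log (2 : ℝ) := Real.log_pos (by norm_num)
  set u := A / (δ * log 2) with hu
  have hu0 : 0 < u := by positivity
  have hp2 : (2 : ℝ) ≤ p := by exact_mod_cast hp.two_le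
  have hj : ((j : ℝ) + 1) ≤ u * exp (((j : ℝ) + 1) / u) := by
    have := Real.add_one_le_exp (((j : ℝ) + 1) / u)
    calc (j : ℝ) + 1 = u * (((j : ℝ) + 1) / u) := by field_simp
      _ ≤ _ := by gcongr; linarith
  have hexp : exp (((j : ℝ) + 1) / u) ^ A = (2 : ℝ) ^ δ * ((2 : ℝ) ^ δ) ^ j := by
    rw [← Real.exp_mul, ← pow_succ', ← Real.rpow_natCast, ← Real.rpow_mul (by norm_num),
      Real.rpow_def_of_pos (by norm_num : (0 : ℝ) < 2), hu]
    congr 1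
    push_cast
    field_simp
  calc (taud d (p ^ j) : ℝ) ^ R ≤ (((j : ℝ) + 1) ^ d) ^ R := by
        gcongr
        exact_mod_cast taud_prime_pow_le d hp j
    _ = ((j : ℝ) + 1) ^ (d * R) := by
        rw [Real.rpow_mul (by positivity), Real.rpow_natCast]
    _ ≤ ((j : ℝ) + 1) ^ A := Real.rpow_le_rpow_of_exponent_le (by linarith [j.cast_nonneg (α := ℝ)]) hRA
    _ ≤ (u * exp (((j : ℝ) + 1) / u)) ^ A := by gcongr
    _ = u ^ A * ((2 : ℝ) ^ δ * ((2 : ℝ) ^ δ) ^ j) := by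
        rw [Real.mul_rpow hu0.le (Real.exp_pos _).le, hexp]
    _ ≤ u ^ A * (2 * ((p : ℝ) ^ δ) ^ j) := by
        have h2 : (2 : ℝ) ^ δ ≤ 2 := by
          calc (2 : ℝ) ^ δ ≤ (2 : ℝ) ^ (1 : ℝ) :=
                Real.rpow_le_rpow_of_exponent_le (by norm_num) hδ1
            _ = 2 := Real.rpow_one 2
        gcongr
    _ = _ := by ring

lemma extra_factor_le {c c' ε w K D δ : ℝ} (hc : 0 ≤ c) (hc' : 0 ≤ c') (hε : 0 < ε) (hw : 3 ≤ w)
    (hlog : 16 * log w ≤ w) (hδ : 0 < δ) (hwδ : 1 / (δ * log 2) ≤ w)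
    (hwε : (47 + c + 3 * c') / ε ≤ w)
    (hK : K = 2 * (16 * log w / (δ * log 2)) ^ (16 * log w)) (hD : D ≤ w) :
    ((⌈2 * w ^ 16⌉₊ : ℝ) + 1) * (K ^ (⌊w ^ 4⌋₊ + 1) * w) * 4 *
      ((3 * K) ^ (⌊w ^ 4⌋₊ + 1) * exp ((D - 1) * c + D * w * (log w + log 4) + 3 * c')) ≤
      exp (ε * w ^ 16) := by
  have hw0 : 0 < w := by linarith
  have hlw : 0 < log w := Real.log_pos (by linarith)
  have hl2 : 0 < log (2 : ℝ) := Real.log_pos (by norm_num)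
  have e1 : (2 : ℝ) ≤ exp 1 := by linarith [Real.add_one_le_exp (1 : ℝ)]
  have e2 : (3 : ℝ) ≤ exp 2 := by linarith [Real.add_one_le_exp (2 : ℝ)]
  have e4 : (4 : ℝ) ≤ exp 2 := by
    calc (4 : ℝ) = 2 * 2 := by norm_num
      _ ≤ exp 1 * exp 1 := by gcongr
      _ = exp 2 := by rw [← Real.exp_add]; norm_num
  have hw16 : w ^ 16 ≤ exp w := by
    rw [← Real.log_le_iff_le_exp (by positivity), Real.log_pow]
    exact_mod_cast hlog
  have hu : 16 * log w / (δ * log 2) ≤ w ^ 2 := by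
    rw [div_eq_mul_one_div]
    calc 16 * log w * (1 / (δ * log 2)) ≤ w * w := by gcongr
      _ = w ^ 2 := by ring
  have hK0 : 0 ≤ K := by rw [hK]; positivity
  have hKle : K ≤ exp (1 + w ^ 2) := by
    rw [hK, Real.exp_add]
    gcongr
    calc (16 * log w / (δ * log 2)) ^ (16 * log w) ≤ (w ^ 2) ^ (16 * log w) := by gcongr
      _ = exp (2 * log w * (16 * log w)) := by
          rw [Real.rpow_def_of_pos (by positivity), Real.log_pow]; norm_num
      _ ≤ exp (w ^ 2) := by
          gcongr
          nlinarith
  have h3K : 3 * K ≤ exp (3 + w ^ 2) := by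
    calc 3 * K ≤ exp 2 * exp (1 + w ^ 2) := by gcongr
      _ = _ := by rw [← Real.exp_add]; ring_nf
  have hpow : ∀ V : ℝ, 0 ≤ V → V ≤ exp (3 + w ^ 2) →
      V ^ (⌊w ^ 4⌋₊ + 1) ≤ exp ((3 + w ^ 2) * (w ^ 4 + 1)) := by
    intro V h0 hV
    calc V ^ (⌊w ^ 4⌋₊ + 1) ≤ exp (3 + w ^ 2) ^ (⌊w ^ 4⌋₊ + 1) := by gcongr
      _ = exp ((3 + w ^ 2) * (⌊w ^ 4⌋₊ + 1)) := by
          rw [← Real.exp_nat_mul]; push_cast; ring_nf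
      _ ≤ _ := by
          gcongr
          exact Nat.floor_le (by positivity)
  have hP1 := hpow K hK0 (hKle.trans (by gcongr; norm_num))
  have hP2 := hpow (3 * K) (by positivity) h3K
  have hN : (⌈2 * w ^ 16⌉₊ : ℝ) + 1 ≤ exp (2 + w) := by
    have h := Nat.ceil_lt_add_one (show 0 ≤ 2 * w ^ 16 by positivity)
    have h1 : 1 ≤ w ^ 16 := one_le_pow₀ (by linarith)
    calc (⌈2 * w ^ 16⌉₊ : ℝ) + 1 ≤ 4 * w ^ 16 := by linarith
      _ ≤ exp 2 * exp w := by gcongr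
      _ = _ := by rw [← Real.exp_add]
  have hwe : w ≤ exp w := by linarith [Real.add_one_le_exp w]
  have hl4 : log 4 ≤ 2 := by
    rw [Real.log_le_iff_le_exp (by norm_num)]; exact e4
  have hl40 : 0 ≤ log (4 : ℝ) := Real.log_nonneg (by norm_num)
  have hexp : (D - 1) * c + D * w * (log w + log 4) + 3 * c' ≤
      w * c + w * w * (w + 2) + 3 * c' := by
    gcongr
    · linarith
    · linarith
  calc ((⌈2 * w ^ 16⌉₊ : ℝ) + 1) * (K ^ (⌊w ^ 4⌋₊ + 1) * w) * 4 *
      ((3 * K) ^ (⌊w ^ 4⌋₊ + 1) * exp ((D - 1) * c + D * w * (log w + log 4) + 3 * c'))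
      ≤ exp (2 + w) * (exp ((3 + w ^ 2) * (w ^ 4 + 1)) * exp w) * exp 2 *
        (exp ((3 + w ^ 2) * (w ^ 4 + 1)) * exp (w * c + w * w * (w + 2) + 3 * c')) := by
        gcongr
    _ = exp (4 + 2 * w + 2 * ((3 + w ^ 2) * (w ^ 4 + 1)) + w * c + w * w * (w + 2) + 3 * c') := by
        simp only [← Real.exp_add]
        congr 1
        ring
    _ ≤ exp (ε * w ^ 16) := by
        gcongr
        have hw1 : 1 ≤ w := by linarith
        rw [div_le_iff₀ hε] at hwε
        have p1 : w ≤ w ^ 6 := le_self_pow₀ hw1 (by norm_num)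
        have p0 : 1 ≤ w ^ 6 := one_le_pow₀ hw1
        have p2 : w ^ 2 ≤ w ^ 6 := pow_le_pow_right₀ hw1 (by norm_num)
        have p3 : w ^ 3 ≤ w ^ 6 := pow_le_pow_right₀ hw1 (by norm_num)
        have p4 : w ^ 4 ≤ w ^ 6 := pow_le_pow_right₀ hw1 (by norm_num)
        calc 4 + 2 * w + 2 * ((3 + w ^ 2) * (w ^ 4 + 1)) + w * c + w * w * (w + 2) + 3 * c'
            = 10 + 2 * w + 4 * w ^ 2 + w ^ 3 + 6 * w ^ 4 + 2 * w ^ 6 + w * c + 3 * c' * 1 := by ring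
          _ ≤ 10 * w ^ 6 + 2 * w ^ 6 + 4 * w ^ 6 + w ^ 6 + 6 * w ^ 6 + 2 * w ^ 6 + w ^ 6 * c +
              3 * c' * w ^ 6 := by gcongr; linarith
          _ = (25 + c + 3 * c') * w ^ 6 := by ring
          _ ≤ (w * ε) * w ^ 6 := by gcongr; linarith
          _ = ε * w ^ 7 := by ring
          _ ≤ ε * w ^ 16 := by gcongr; norm_num

lemma two_mul_exp_exp_le {w : ℝ} (hw : 3 ≤ w) :
    2 * exp (exp (w ^ 16)) ≤ w ^ (8 * 2 ^ ⌈2 * w ^ 16⌉₊) := by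
  have e1 : exp 1 ≤ w := by linarith [Real.exp_one_lt_d9]
  have hN : exp (w ^ 16) ≤ (2 : ℝ) ^ ⌈2 * w ^ 16⌉₊ := by
    rw [← Real.rpow_natCast 2, Real.rpow_def_of_pos (by norm_num)]
    gcongr
    have h1 : (1 : ℝ) / 2 ≤ log 2 := by linarith [Real.log_two_gt_d9]
    calc w ^ 16 = 1 / 2 * (2 * w ^ 16) := by ring
      _ ≤ log 2 * ⌈2 * w ^ 16⌉₊ := by
          gcongr
          exact Nat.le_ceil _
  have h0 : 1 ≤ (2 : ℝ) ^ ⌈2 * w ^ 16⌉₊ := one_le_pow₀ (by norm_num)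
  calc 2 * exp (exp (w ^ 16)) ≤ exp 1 * exp (exp (w ^ 16)) := by
        gcongr
        linarith [Real.add_one_le_exp (1 : ℝ)]
    _ = exp (1 + exp (w ^ 16)) := by rw [Real.exp_add]
    _ ≤ exp (((8 * 2 ^ ⌈2 * w ^ 16⌉₊ : ℕ) : ℝ) * 1) := by
        gcongr
        push_cast
        linarith
    _ = exp 1 ^ (8 * 2 ^ ⌈2 * w ^ 16⌉₊) := by rw [Real.exp_nat_mul]
    _ ≤ _ := by gcongr

lemma exists_sum_taud_rpow_le {α ε : ℝ} (hα : 0 < α) (hα1 : α ≤ 1) (hε : 0 < ε) (d : ℕ) :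
    ∃ w₀ : ℝ, ∀ w : ℝ, w₀ ≤ w → ∀ R : ℝ, 0 ≤ R → ((d + 1 : ℕ) : ℝ) * R ≤ 16 * log w →
      R * log ((d + 1 : ℕ) : ℝ) ≤ α / 8 * log w → ∀ x : ℝ, x = exp (exp (w ^ 16)) →
      ∀ k a : ℕ, 1 ≤ k → (k : ℝ) ≤ x ^ (1 - α) → Nat.gcd a k = 1 →
      ∀ S : Finset ℕ, (∀ n ∈ S, x ≤ n ∧ (n : ℝ) ≤ 2 * x ∧ n % k = a % k) →
      ∑ n ∈ S, (taud (d + 1) n : ℝ) ^ R ≤ x * log x ^ ε / (Nat.totient k : ℝ) *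
        ((Nat.totient k : ℝ) / k * log x) ^ (((d + 1 : ℕ) : ℝ) ^ R - 1) := by
  obtain ⟨c, hc, hmertens⟩ := exists_sum_inv_prime_not_dvd_le
  set c' := ∑' n : ℕ, 1 / (n : ℝ) ^ (3 / 2 : ℝ) with hc'
  have hc'0 : 0 ≤ c' := tsum_nonneg fun n => by positivity
  have hl2 : 0 < log (2 : ℝ) := Real.log_pos (by norm_num)
  set δ := α / 32 with hδ
  have hδ0 : 0 < δ := by positivity
  have hev : ∀ᶠ w : ℝ in Filter.atTop, 16 * log w ≤ w := by
    have := Real.isLittleO_log_id_atTop.bound (show (0 : ℝ) < 1 / 16 by norm_num)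
    filter_upwards [this, Filter.eventually_ge_atTop 1] with w hw hw1
    rw [Real.norm_of_nonneg (Real.log_nonneg hw1), id, Real.norm_of_nonneg (by linarith)] at hw
    linarith
  obtain ⟨w₀, hw₀⟩ := Filter.eventually_atTop.mp (hev.and
    ((Filter.eventually_ge_atTop 3).and ((Filter.eventually_ge_atTop (1 / (δ * log 2))).and
    (Filter.eventually_ge_atTop ((47 + c + 3 * c') / ε)))))
  refine ⟨w₀, fun w hw R hR hRA hRD x hx k a hk hkx ha S hS => ?_⟩
  obtain ⟨hlog, hw3, hwδ, hwε⟩ := hw₀ w hw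
  have hw0 : 0 < w := by linarith
  have hlw : 0 < log w := Real.log_pos (by linarith)
  set D := ((d + 1 : ℕ) : ℝ) ^ R with hD
  have hf := divisorLike_taud d hR
  have hD1 : 1 ≤ D := hf.one_le_D
  have hlogD : log D ≤ α / 8 * log w := by
    rw [hD, Real.log_rpow (by positivity)]
    exact hRD
  have hDw : D ≤ w ^ (α / 8) := by
    rw [Real.le_rpow_iff_log_le (by linarith) hw0]
    exact hlogD
  have hDw1 : D ≤ w := by
    refine hDw.trans ?_
    calc w ^ (α / 8) ≤ w ^ (1 : ℝ) :=
          Real.rpow_le_rpow_of_exponent_le (by linarith) (by linarith)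
      _ = w := Real.rpow_one w
  set K := 2 * (16 * log w / (δ * log 2)) ^ (16 * log w) with hK
  have hsmall : ∀ p : ℕ, p.Prime → ∀ j : ℕ,
      (taud (d + 1) (p ^ j) : ℝ) ^ R ≤ K * ((p : ℝ) ^ δ) ^ j := fun p hp j =>
    taud_rpow_prime_pow_le (d + 1) (by positivity) hR hRA hδ0 (by linarith) hp j
  have hK1 : 1 ≤ K := by
    have := hsmall 2 Nat.prime_two 0
    simpa [taud_one] using this
  have hpδ : ∀ p : ℕ, p.Prime → (p : ℝ) ^ δ ≤ (p : ℝ) ^ (1 / 8 : ℝ) := fun p hp =>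
    Real.rpow_le_rpow_of_exponent_le (by exact_mod_cast hp.one_le) (by linarith)
  have hlarge : ∀ p : ℕ, p.Prime → ⌊w ^ 4⌋₊ < p → D ≤ (p : ℝ) ^ δ := by
    intro p _ hpy
    have hp4 : w ^ 4 ≤ p := (Nat.lt_of_floor_lt hpy).le
    calc D ≤ w ^ (α / 8) := hDw
      _ = (w ^ 4) ^ δ := by
          rw [← Real.rpow_natCast, ← Real.rpow_mul hw0.le, hδ]
          congr 1
          push_cast
          ring
      _ ≤ (p : ℝ) ^ δ := by gcongr
  have hx2 : 2 ≤ x := by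
    rw [hx]
    have h1 := Real.add_one_le_exp (w ^ 16)
    have h2 := Real.add_one_le_exp (exp (w ^ 16))
    have h3 : 0 ≤ w ^ 16 := by positivity
    linarith
  have hlx : log x = exp (w ^ 16) := by rw [hx, Real.log_exp]
  have hkx1 : (k : ℝ) ≤ x := hkx.trans <| by
    calc x ^ (1 - α) ≤ x ^ (1 : ℝ) :=
          Real.rpow_le_rpow_of_exponent_le (by linarith) (by linarith)
      _ = x := Real.rpow_one x
  have hZk : x ^ (α / 2) * k ≤ 2 * x := by
    calc x ^ (α / 2) * k ≤ x ^ (α / 2) * x ^ (1 - α) := by gcongr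
      _ = x ^ (1 - α / 2) := by rw [← Real.rpow_add (by linarith)]; ring_nf
      _ ≤ x ^ (1 : ℝ) := Real.rpow_le_rpow_of_exponent_le (by linarith) (by linarith)
      _ ≤ 2 * x := by rw [Real.rpow_one]; linarith
  have hmain := hf.sum_progression_le (y := ⌊w ^ 4⌋₊) (E := K ^ (⌊w ^ 4⌋₊ + 1)) hx2 hα hα1 hK1
    (by linarith : 1 < w) (one_le_pow₀ hK1) (by linarith)
    (hx ▸ two_mul_exp_exp_le hw3) (fun p hp j => (hsmall p hp j).trans (by
      have := hpδ p hp
      gcongr))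
    (fun p hp hy => (hlarge p hp hy).trans (hpδ p hp))
    (fun n hn => hf.le_pow_mul_rpow hK1 hsmall hlarge hn) hk hZk ha hS
    (hmertens x k hx2 hk hkx1)
  refine hmain.trans ?_
  have hφ : 0 < (Nat.totient k : ℝ) := by exact_mod_cast Nat.totient_pos.mpr hk
  have hφk : (Nat.totient k : ℝ) ≤ k := by exact_mod_cast Nat.totient_le k
  have hk0 : (0 : ℝ) < k := by exact_mod_cast hk
  have hV : 0 < (Nat.totient k : ℝ) / k * log x := by
    rw [hlx]
    positivity
  set V := (Nat.totient k : ℝ) / k * log x with hVdef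
  have hfac := extra_factor_le hc hc'0 hε hw3 hlog hδ0 hwδ hwε hK hDw1
  have hsplit : exp ((D - 1) * (log V + c) + D * w * (log w + log 4) + 3 * c') =
      V ^ (D - 1) * exp ((D - 1) * c + D * w * (log w + log 4) + 3 * c') := by
    rw [Real.rpow_def_of_pos hV, ← Real.exp_add]
    congr 1
    ring
  rw [hsplit]
  have hxε : log x ^ ε = exp (ε * w ^ 16) := by
    rw [hlx, ← Real.exp_mul, mul_comm]
  rw [hxε]
  have hx0 : 0 < x := by linarith
  calc _ = x / k * V ^ (D - 1) *
        (((⌈2 * w ^ 16⌉₊ : ℝ) + 1) * (K ^ (⌊w ^ 4⌋₊ + 1) * w) * 4 *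
      ((3 * K) ^ (⌊w ^ 4⌋₊ + 1) * exp ((D - 1) * c + D * w * (log w + log 4) + 3 * c'))) := by
        ring
    _ ≤ x / Nat.totient k * V ^ (D - 1) * exp (ε * w ^ 16) := by gcongr
    _ = _ := by ring

end DivisorBound

/-- Theorem 4 (`dfold`), first part: powers of the `d`-fold divisor function
in short intervals of arithmetic progressions, with exponent
`R = (log log log x)/g(x)` where `g(x) → ∞`. -/
theorem dfold_divisor_power_bound (α κ ε : ℝ) (hα : 0 < α) (hα' : α < 1/2)
    (hκ : 0 < κ) (hκ' : κ < 1/2) (hε : 0 < ε) (d : ℕ) (hd : 2 ≤ d)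
    (g : ℝ → ℝ) (hg : Filter.Tendsto g Filter.atTop Filter.atTop) :
    ∃ C : ℝ, 0 < C ∧ ∃ x0 : ℝ, ∀ x : ℝ, x0 ≤ x →
      ∀ y : ℝ, x ^ κ ≤ y → y ≤ x →
      ∀ k : ℕ, 1 ≤ k → (k : ℝ) < y ^ (1 - α) →
      ∀ a : ℕ, Nat.gcd a k = 1 →
      ∑ n ∈ (Finset.Icc 1 ⌊x + y⌋₊).filter
          (fun n : ℕ => x ≤ (n : ℝ) ∧ (n : ℝ) ≤ x + y ∧ n % k = a % k),
          (taud d n : ℝ) ^ (Real.log (Real.log (Real.log x)) / g x)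
        ≤ C * (x * Real.log x ^ ε / (Nat.totient k : ℝ)) *
          (((Nat.totient k : ℝ) / (k : ℝ)) * Real.log x) ^
            ((d : ℝ) ^ (Real.log (Real.log (Real.log x)) / g x) - 1) := by
  obtain ⟨e, rfl⟩ : ∃ e, d = e + 1 := ⟨d - 1, by omega⟩
  obtain ⟨w₀, hw₀⟩ := DivisorBound.exists_sum_taud_rpow_le hα (by linarith) hε e
  have hll : Filter.Tendsto (fun x : ℝ => Real.log (Real.log x)) Filter.atTop Filter.atTop :=
    Real.tendsto_log_atTop.comp Real.tendsto_log_atTop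
  have hw : Filter.Tendsto (fun x : ℝ => Real.log (Real.log x) ^ (1 / 16 : ℝ)) Filter.atTop
      Filter.atTop := (tendsto_rpow_atTop (by norm_num)).comp hll
  obtain ⟨x0, hx0⟩ := Filter.eventually_atTop.mp ((hw.eventually_ge_atTop w₀).and
    ((hll.eventually_ge_atTop 1).and ((Filter.eventually_gt_atTop (Real.exp 1)).and
    ((hg.eventually_ge_atTop ((e + 1 : ℕ) : ℝ)).and
    (hg.eventually_ge_atTop (128 * Real.log ((e + 1 : ℕ) : ℝ) / α))))))
  refine ⟨1, one_pos, x0, fun x hx y hxy hyx k hk hky a ha => ?_⟩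
  obtain ⟨hwx, hL1, hxe, hge, hgα⟩ := hx0 x hx
  have hx1 : 1 < x := lt_trans (by linarith [Real.add_one_le_exp (1 : ℝ)]) hxe
  have hxpos : 0 < x := by linarith
  have hlx : 1 < Real.log x := by rwa [Real.lt_log_iff_exp_lt hxpos]
  set L := Real.log (Real.log x) with hL
  set w := L ^ (1 / 16 : ℝ) with hwdef
  have hL0 : 0 < L := by linarith
  have hw16 : w ^ 16 = L := by
    rw [hwdef, ← Real.rpow_natCast, ← Real.rpow_mul hL0.le]
    norm_num
  have hlogw : 16 * Real.log w = Real.log L := by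
    rw [hwdef, Real.log_rpow hL0]
    ring
  have hxw : x = Real.exp (Real.exp (w ^ 16)) := by
    rw [hw16, hL, Real.exp_log (by linarith), Real.exp_log hxpos]
  have he1 : (1 : ℝ) ≤ ((e + 1 : ℕ) : ℝ) := by exact_mod_cast Nat.le_add_left 1 e
  have hgpos : 0 < g x := by linarith
  have hlogL : 0 ≤ Real.log L := Real.log_nonneg hL1
  have hy0 : 0 ≤ y := le_trans (by positivity) hxy
  rw [one_mul]
  refine hw₀ w hwx _ (by positivity) ?_ ?_ x hxw k a hk ?_ ha _ ?_
  · rw [hlogw, ← mul_div_assoc, div_le_iff₀ hgpos, mul_comm]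
    gcongr
  · rw [div_mul_eq_mul_div, div_le_iff₀ hgpos, ← hlogw]
    rw [div_le_iff₀ hα] at hgα
    have : 0 ≤ Real.log w := by linarith
    nlinarith
  · refine hky.le.trans ?_
    gcongr
    linarith
  · intro n hn
    obtain ⟨-, h1, h2, h3⟩ := Finset.mem_filter.mp hn
    exact ⟨h1, by linarith, h3⟩
end
end

section
/- Fix constants A > 0 and C3 with C3 > 1 − C2, where C2 = (5/656) · (ακ(1 − ακ/20)/20) for some admissible choice of 0 < α < 1/2, 0 < κ < 1/2. Then there exist a constant A' > 0 and a threshold x0 such that the following holds for all x ≥ x0. Let Q ≥ 2, set u = (log x)/(log Q), and assume u ≥ (log log x)², u ≥ 3. Let y satisfy x^κ ≤ y ≤ x, and assume the hypothesis ∑_{x < n ≤ x + y, n Q-smooth} τ(n) ≥ y · exp(−u(log u + log log u + A)). Then #{n ∈ ℤ : x < n ≤ x + y, n Q-smooth} ≥ y · exp(−(1 + C3 · (log log log log x)/(log log log x)) · u · (log u + log log u + A')). -/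
open Finset

noncomputable section

theorem card_divisors_mul_le (a b : ℕ) :
    #(a * b).divisors ≤ #a.divisors * #b.divisors := by
  rw [Nat.divisors_mul]
  exact Finset.card_mul_le

/-- An integer exceeding `S` all of whose prime factors are at most `S` has a divisor in
`(S, S ^ 2]`. -/
theorem exists_dvd_mem_Ioc_of_smooth {S : ℝ} (hS : 1 ≤ S) (n : ℕ)
    (hn : ∀ p ∈ n.primeFactors, (p : ℝ) ≤ S) (hSn : S < n) :
    ∃ d : ℕ, d ∣ n ∧ S < d ∧ (d : ℝ) ≤ S ^ 2 := by
  induction n using Nat.strong_induction_on with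
  | _ n ih =>
    by_cases h : (n : ℝ) ≤ S ^ 2
    · exact ⟨n, dvd_rfl, hSn, h⟩
    · push Not at h
      have hn1 : 1 < n := by exact_mod_cast hS.trans_lt hSn
      have hp : n.minFac.Prime := Nat.minFac_prime hn1.ne'
      obtain ⟨q, hq⟩ := n.minFac_dvd
      have hpS := hn n.minFac (Nat.mem_primeFactors.2 ⟨hp, n.minFac_dvd, by omega⟩)
      have hqn : q ∣ n := ⟨n.minFac, by rw [mul_comm]; exact hq⟩
      have hq0 : 0 < q := Nat.pos_of_dvd_of_pos hqn (by omega)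
      have hqlt : q < n := by
        have := hp.two_le
        calc q < 2 * q := by omega
          _ ≤ n.minFac * q := Nat.mul_le_mul_right _ this
          _ = n := hq.symm
      have hSq : S < q := by
        have h1 : (n : ℝ) = n.minFac * q := by exact_mod_cast hq
        have h2 : (n.minFac : ℝ) * q ≤ S * q := by gcongr
        nlinarith
      obtain ⟨d, hd, h1, h2⟩ := ih q hqlt
        (fun p hp => hn p (Nat.primeFactors_mono hqn (by omega) hp)) hSq
      exact ⟨d, hd.trans hqn, h1, h2⟩

/-- A Landreau-type inequality: the divisor function of an `S`-smooth integer `n ≤ S ^ m` is at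
most the `m`-th power of its value at some divisor of `n` not exceeding `S ^ 2`. -/
theorem exists_dvd_card_divisors_le_pow_of_smooth {S : ℝ} (hS : 1 ≤ S) (m n : ℕ) (hn0 : 0 < n)
    (hn : ∀ p ∈ n.primeFactors, (p : ℝ) ≤ S) (hSn : (n : ℝ) ≤ S ^ m) :
    ∃ d : ℕ, d ∣ n ∧ (d : ℝ) ≤ S ^ 2 ∧ #n.divisors ≤ #d.divisors ^ m := by
  induction m generalizing n with
  | zero =>
    have : n = 1 := by
      have : n ≤ 1 := by exact_mod_cast (by simpa using hSn : (n : ℝ) ≤ 1)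
      omega
    subst this
    exact ⟨1, dvd_rfl, by push_cast; exact one_le_pow₀ hS, by simp⟩
  | succ m ih =>
    have hS0 : 0 < S := by linarith
    by_cases h : (n : ℝ) ≤ S ^ 2
    · exact ⟨n, dvd_rfl, h, Nat.le_self_pow (by omega) _⟩
    · push Not at h
      obtain ⟨d, ⟨q, hq⟩, h1, h2⟩ := exists_dvd_mem_Ioc_of_smooth hS n hn (by nlinarith)
      have hqn : q ∣ n := ⟨d, by rw [mul_comm]; exact hq⟩
      have hq0 : 0 < q := Nat.pos_of_dvd_of_pos hqn hn0
      have hqS : (q : ℝ) ≤ S ^ m := by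
        have h3 : (n : ℝ) = d * q := by exact_mod_cast hq
        have h4 : S * q ≤ d * q := by gcongr
        have h5 : S * q ≤ S * S ^ m := by rw [← pow_succ']; linarith
        exact le_of_mul_le_mul_left h5 hS0
      obtain ⟨e, he, he2, hτ⟩ := ih q hq0
        (fun p hp => hn p (Nat.primeFactors_mono hqn (by omega) hp)) hqS
      have hmul : #n.divisors ≤ #d.divisors * #q.divisors := by
        rw [hq]; exact card_divisors_mul_le d q
      rcases le_total #d.divisors #e.divisors with hde | hde
      · refine ⟨e, he.trans hqn, he2, hmul.trans ?_⟩
        rw [pow_succ']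
        exact Nat.mul_le_mul hde hτ
      · refine ⟨d, ⟨q, hq⟩, h2, hmul.trans ?_⟩
        rw [pow_succ']
        exact Nat.mul_le_mul_left _ (hτ.trans (Nat.pow_le_pow_left hde m))

theorem sum_card_divisors_pow_succ_div_le_sq (N j : ℕ) :
    ∑ d ∈ Icc 1 N, (#d.divisors : ℝ) ^ (j + 1) / d ≤
      (∑ d ∈ Icc 1 N, (#d.divisors : ℝ) ^ j / d) ^ 2 := by
  have key : ∀ d ∈ Icc 1 N, (#d.divisors : ℝ) ^ (j + 1) / d ≤
      ∑ p ∈ d.divisorsAntidiagonal,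
        (#p.1.divisors : ℝ) ^ j / p.1 * ((#p.2.divisors : ℝ) ^ j / p.2) := by
    intro d _
    have hcard : #d.divisors = #d.divisorsAntidiagonal := by
      rw [← Nat.map_div_right_divisors, card_map]
    calc (#d.divisors : ℝ) ^ (j + 1) / d
        = ∑ _p ∈ d.divisorsAntidiagonal, (#d.divisors : ℝ) ^ j / d := by
          rw [sum_const, ← hcard, nsmul_eq_mul]; ring
      _ ≤ _ := by
          refine sum_le_sum fun p hp => ?_
          have hpd := (Nat.mem_divisorsAntidiagonal.1 hp).1
          rw [div_mul_div_comm, ← mul_pow, ← hpd, Nat.cast_mul]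
          gcongr
          exact_mod_cast card_divisors_mul_le p.1 p.2
  refine (sum_le_sum key).trans ?_
  have hfib : ∀ d ∈ Icc 1 N,
      d.divisorsAntidiagonal = {p ∈ Icc 1 N ×ˢ Icc 1 N | p.1 * p.2 = d} := by
    intro d hd
    obtain ⟨hd1, hd2⟩ := mem_Icc.1 hd
    ext ⟨a, b⟩
    simp only [Nat.mem_divisorsAntidiagonal, mem_filter, mem_product, mem_Icc]
    constructor
    · rintro ⟨rfl, h⟩
      have ha : 0 < a := Nat.pos_of_ne_zero (by rintro rfl; simp at h)
      have hb : 0 < b := Nat.pos_of_ne_zero (by rintro rfl; simp at h)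
      exact ⟨⟨⟨ha, (Nat.le_mul_of_pos_right a hb).trans hd2⟩,
        hb, (Nat.le_mul_of_pos_left b ha).trans hd2⟩, rfl⟩
    · rintro ⟨-, rfl⟩
      exact ⟨rfl, by omega⟩
  rw [sum_congr rfl fun d hd => sum_congr (hfib d hd) fun _ _ => rfl, sq, sum_mul_sum,
    ← sum_product']
  exact sum_fiberwise_le_sum_of_sum_fiber_nonneg
    fun _ _ => sum_nonneg fun _ _ => by positivity

theorem sum_card_divisors_pow_div_le (N j : ℕ) :
    ∑ d ∈ Icc 1 N, (#d.divisors : ℝ) ^ j / d ≤ (1 + Real.log N) ^ 2 ^ j := by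
  induction j with
  | zero =>
    have := harmonic_le_one_add_log N
    rw [harmonic_eq_sum_Icc] at this
    simpa using this
  | succ j ih =>
    refine (sum_card_divisors_pow_succ_div_le_sq N j).trans ?_
    rw [pow_succ 2 j, pow_mul]
    gcongr

theorem card_filter_dvd_le {x y : ℝ} (hx : 0 ≤ x) (hy : 0 ≤ y) (F : Finset ℕ)
    (hF : ∀ n ∈ F, x < n ∧ (n : ℝ) ≤ x + y) {d : ℕ} (hd : 0 < d) :
    (#{n ∈ F | d ∣ n} : ℝ) ≤ y / d + 1 := by
  have hd' : (0 : ℝ) < d := by exact_mod_cast hd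
  have hle : #{n ∈ F | d ∣ n} ≤ #(Ioc ⌊x / d⌋₊ ⌊(x + y) / d⌋₊) := by
    refine card_le_card_of_injOn (fun n => n / d) ?_ ?_
    · intro n hn
      obtain ⟨hn, q, rfl⟩ := mem_filter.1 hn
      obtain ⟨h1, h2⟩ := hF _ hn
      push_cast at h1 h2
      simp only [coe_Ioc, Set.mem_Ioc, Nat.mul_div_cancel_left q hd]
      refine ⟨(Nat.floor_lt (by positivity)).2 ?_, Nat.le_floor ?_⟩
      · rw [div_lt_iff₀ hd']; linarith
      · rw [le_div_iff₀ hd']; linarith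
    · intro a ha b hb hab
      have ha := (mem_filter.1 ha).2
      have hb := (mem_filter.1 hb).2
      exact (Nat.div_left_inj ha hb).1 hab
  have hfl : ⌊x / d⌋₊ ≤ ⌊(x + y) / d⌋₊ := Nat.floor_le_floor (by gcongr; linarith)
  rw [Nat.card_Ioc] at hle
  have hle' : (#{n ∈ F | d ∣ n} : ℝ) ≤ (⌊(x + y) / d⌋₊ : ℝ) - ⌊x / d⌋₊ := by
    rw [← Nat.cast_sub hfl]; exact_mod_cast hle
  have h1 := Nat.floor_le (show 0 ≤ (x + y) / d by positivity)
  have h2 := Nat.lt_floor_add_one (x / d)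
  have h3 : (x + y) / d = x / d + y / d := add_div _ _ _
  linarith

/-- Moments of the divisor function over smooth integers in a short interval. -/
theorem sum_card_divisors_pow_le_of_smooth {x y S : ℝ} (hx : 0 ≤ x) (hS : 1 ≤ S)
    (hSy : S ^ 2 ≤ y) (m k : ℕ) (hm : x + y ≤ S ^ m) (F : Finset ℕ)
    (hF : ∀ n ∈ F, x < n ∧ (n : ℝ) ≤ x + y) (hFS : ∀ n ∈ F, ∀ p ∈ n.primeFactors, (p : ℝ) ≤ S) :
    ∑ n ∈ F, (#n.divisors : ℝ) ^ k ≤ y * (2 * (1 + Real.log (S ^ 2)) ^ 2 ^ (m * k)) := by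
  have hS2 : 1 ≤ S ^ 2 := one_le_pow₀ hS
  have hy : 0 < y := by linarith
  have h1 : ∀ n ∈ F, (#n.divisors : ℝ) ^ k ≤
      ∑ d ∈ Icc 1 ⌊S ^ 2⌋₊, if d ∣ n then (#d.divisors : ℝ) ^ (m * k) else 0 := by
    intro n hn
    obtain ⟨hxn, hny⟩ := hF n hn
    have hn0 : 0 < n := by exact_mod_cast hx.trans_lt hxn
    obtain ⟨d, hd, hdS, hτ⟩ := exists_dvd_card_divisors_le_pow_of_smooth hS m n hn0
      (hFS n hn) (hny.trans hm)
    have hmem : d ∈ Icc 1 ⌊S ^ 2⌋₊ :=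
      mem_Icc.2 ⟨Nat.pos_of_dvd_of_pos hd hn0, Nat.le_floor hdS⟩
    refine le_trans ?_ (single_le_sum (fun i _ => by positivity) hmem)
    rw [if_pos hd, pow_mul]
    gcongr
    exact_mod_cast hτ
  refine (sum_le_sum h1).trans ?_
  rw [sum_comm]
  have h2 : ∀ d ∈ Icc 1 ⌊S ^ 2⌋₊,
      (∑ n ∈ F, if d ∣ n then (#d.divisors : ℝ) ^ (m * k) else 0) ≤
        2 * y * ((#d.divisors : ℝ) ^ (m * k) / d) := by
    intro d hd
    obtain ⟨hd1, hd2⟩ := mem_Icc.1 hd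
    have hd' : (0 : ℝ) < d := by exact_mod_cast hd1
    have hdy : (d : ℝ) ≤ y := ((Nat.le_floor_iff (by positivity)).1 hd2).trans hSy
    rw [← sum_filter, sum_const, nsmul_eq_mul]
    have h3 := card_filter_dvd_le hx hy.le F hF hd1
    have h4 : (1 : ℝ) ≤ y / d := (one_le_div hd').2 hdy
    calc (#{n ∈ F | d ∣ n} : ℝ) * (#d.divisors : ℝ) ^ (m * k)
        ≤ (2 * (y / d)) * (#d.divisors : ℝ) ^ (m * k) := by gcongr; linarith
      _ = _ := by ring
  refine (sum_le_sum h2).trans ?_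
  rw [← mul_sum]
  have h5 := sum_card_divisors_pow_div_le ⌊S ^ 2⌋₊ (m * k)
  have hfl : 1 ≤ ⌊S ^ 2⌋₊ := Nat.le_floor (by simpa using hS2)
  have hfl' : (1 : ℝ) ≤ ⌊S ^ 2⌋₊ := by exact_mod_cast hfl
  have h6 : Real.log ⌊S ^ 2⌋₊ ≤ Real.log (S ^ 2) :=
    Real.log_le_log (by linarith) (Nat.floor_le (by positivity))
  have h7 := Real.log_nonneg hfl'
  calc 2 * y * _ ≤ 2 * y * (1 + Real.log ⌊S ^ 2⌋₊) ^ 2 ^ (m * k) := by gcongr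
    _ ≤ 2 * y * (1 + Real.log (S ^ 2)) ^ 2 ^ (m * k) := by gcongr
    _ = _ := by ring

/-- A lower bound for the number of terms of a sum whose `(K + 1)`-st moment is controlled. -/
theorem mul_exp_le_card_of_moment_le {ι : Type*} (F : Finset ι) (f : ι → ℝ)
    (hf : ∀ i ∈ F, 0 ≤ f i) {y E c : ℝ} {K : ℕ} (hy : 0 < y) (hE : 0 ≤ E) (hK : K ≠ 0)
    (hc : 3 / 2 ≤ c * K) (hsum : y * Real.exp (-E) ≤ ∑ i ∈ F, f i)
    (hmom : ∑ i ∈ F, f i ^ (K + 1) ≤ y * Real.exp (E / 2)) :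
    y * Real.exp (-(1 + c) * E) ≤ #F := by
  have hF : (0 : ℝ) < #F := by
    rcases F.eq_empty_or_nonempty with rfl | h
    · have : 0 < y * Real.exp (-E) := by positivity
      simp only [sum_empty] at hsum
      linarith
    · exact_mod_cast h.card_pos
  have h1 := pow_sum_div_card_le_sum_pow hf K
  rw [div_le_iff₀ (by positivity)] at h1
  have h2 : (y * Real.exp (-E)) ^ (K + 1) ≤ (∑ i ∈ F, f i) ^ (K + 1) := by gcongr
  have h3 : (y * Real.exp (-E)) ^ (K + 1) ≤ y * Real.exp (E / 2) * (#F : ℝ) ^ K :=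
    h2.trans (h1.trans (by gcongr))
  refine le_of_pow_le_pow_left₀ hK hF.le ?_
  refine le_of_mul_le_mul_left (le_trans ?_ h3) (by positivity : 0 < y * Real.exp (E / 2))
  have h4 : y * Real.exp (E / 2) * (y * Real.exp (-(1 + c) * E)) ^ K =
      y ^ (K + 1) * Real.exp (E / 2 + K * (-(1 + c) * E)) := by
    rw [mul_pow, ← Real.exp_nat_mul, Real.exp_add]; ring
  rw [h4, mul_pow, ← Real.exp_nat_mul]
  gcongr
  push_cast
  nlinarith

theorem moment_factor_le_exp {L E z : ℝ} {m K : ℕ} (hL : 2 ≤ L)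
    (hl : 8 * m + 8 ≤ Real.log (Real.log L))
    (hr : 8 * m + 8 ≤ Real.log (Real.log (Real.log L)))
    (hK : (K : ℝ) ≤ 2 * Real.log (Real.log L) / Real.log (Real.log (Real.log L)) + 1)
    (hz : 0 ≤ z) (hzL : z ≤ L) (hE : Real.log L ^ 2 ≤ E) :
    2 * (1 + z) ^ 2 ^ (m * (K + 1)) ≤ Real.exp (E / 2) := by
  have hm0 : (0 : ℝ) ≤ m := Nat.cast_nonneg m
  have hL2pos : 0 < Real.log L := Real.log_pos (by linarith)
  set l := Real.log (Real.log L)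
  set r := Real.log l
  have hr0 : 0 < r := by linarith
  have h2e : (2 : ℝ) ≤ Real.exp 1 := by
    have := Real.add_one_le_exp 1
    linarith
  set s := Real.exp (l / 2) with hs_def
  have hs : s * s = Real.log L := by
    rw [hs_def, ← Real.exp_add, add_halves, Real.exp_log hL2pos]
  have hs5 : 5 ≤ s := by
    have := Real.add_one_le_exp (l / 2)
    linarith
  have hpow : ((2 ^ (m * (K + 1)) : ℕ) : ℝ) ≤ s := by
    have h5 : (m : ℝ) * (2 * l / r) ≤ l / 4 := by
      rw [← mul_div_assoc, div_le_iff₀ hr0]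
      nlinarith
    have h6 : (m : ℝ) * (K + 1) ≤ l / 2 := by nlinarith
    calc ((2 ^ (m * (K + 1)) : ℕ) : ℝ) = 2 ^ (m * (K + 1)) := by push_cast; rfl
      _ ≤ Real.exp 1 ^ (m * (K + 1)) := by gcongr
      _ = Real.exp (m * (K + 1)) := by rw [← Real.exp_nat_mul]; push_cast; ring_nf
      _ ≤ s := Real.exp_le_exp.2 h6
  have hD : 1 + z ≤ Real.exp (2 * Real.log L) := by
    have h5 : Real.exp (2 * Real.log L) = L ^ 2 := by
      rw [two_mul, Real.exp_add, Real.exp_log (by linarith), sq]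
    rw [h5]
    nlinarith
  have hD0 : 0 ≤ 1 + z := by linarith
  calc 2 * (1 + z) ^ 2 ^ (m * (K + 1))
      ≤ Real.exp 1 * Real.exp (2 * Real.log L) ^ 2 ^ (m * (K + 1)) := by gcongr
    _ = Real.exp (1 + (2 ^ (m * (K + 1)) : ℕ) * (2 * Real.log L)) := by
        rw [← Real.exp_nat_mul, Real.exp_add]
    _ ≤ Real.exp (1 + s * (2 * Real.log L)) := by gcongr
    _ ≤ Real.exp (E / 2) := by
        refine Real.exp_le_exp.2 ?_
        rw [← hs] at hE ⊢
        have h5 : 0 ≤ (s - 5) * (s * s * s) := mul_nonneg (by linarith) (by positivity)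
        have h6 : 5 * 5 * 5 ≤ s * s * s := by gcongr
        nlinarith

/-- Theorem 5 (`smooththm`), stated in explicit exponential form: if the count
of divisors of `Q`-smooth integers in `(x, x+y]` is at least
`y · exp(-u(log u + log log u + A))` (the Soundararajan/Goudout input,
encoding `y·ρ(u/2)² ≪ ∑ τ(n)`), with `u = log x / log Q ≥ max{(log log x)², 3}`,
then the number of `Q`-smooth integers in `(x, x+y]` is at least
`y · exp(-(1 + C3·(log₄x)/(log₃x))·u·(log u + log log u + A'))`,
i.e. `ψ(x+y,Q) - ψ(x,Q) ≫ y·ρ(u)^(1 + C3·(log₄x)/(log₃x))`,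
for any `C3 > 1 - C2` where `C2 = (5/656)·(ακ(1-ακ/20)/20)`. -/
theorem smooth_short_interval_lower_bound (α κ A C3 : ℝ)
    (hα : 0 < α) (hα' : α < 1/2) (hκ : 0 < κ) (hκ' : κ < 1/2) (hA : 0 < A)
    (hC3 : 1 - 5 / 656 * (α * κ * (1 - α * κ / 20) / 20) < C3) :
    ∃ A' : ℝ, 0 < A' ∧ ∃ x0 : ℝ, ∀ x : ℝ, x0 ≤ x →
      ∀ Q : ℝ, 2 ≤ Q →
      Real.log (Real.log x) ^ (2 : ℕ) ≤ Real.log x / Real.log Q →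
      3 ≤ Real.log x / Real.log Q →
      ∀ y : ℝ, x ^ κ ≤ y → y ≤ x →
      y * Real.exp (-(Real.log x / Real.log Q) *
            (Real.log (Real.log x / Real.log Q) +
              Real.log (Real.log (Real.log x / Real.log Q)) + A))
          ≤ ∑ n ∈ (Finset.Icc 1 ⌊x + y⌋₊).filter
              (fun n : ℕ => x < (n : ℝ) ∧ (n : ℝ) ≤ x + y ∧
                ∀ p ∈ n.primeFactors, (p : ℝ) ≤ Q),
              (n.divisors.card : ℝ) →
      y * Real.exp (-(1 + C3 * Real.log (Real.log (Real.log (Real.log x))) /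
              Real.log (Real.log (Real.log x))) *
            (Real.log x / Real.log Q) *
            (Real.log (Real.log x / Real.log Q) +
              Real.log (Real.log (Real.log x / Real.log Q)) + A'))
        ≤ (((Finset.Icc 1 ⌊x + y⌋₊).filter
            (fun n : ℕ => x < (n : ℝ) ∧ (n : ℝ) ≤ x + y ∧
              ∀ p ∈ n.primeFactors, (p : ℝ) ≤ Q)).card : ℝ) := by
  set m : ℕ := ⌈4 / κ⌉₊
  have hm : 4 / κ ≤ m := Nat.le_ceil _
  have hC3' : 3 / 4 ≤ C3 := by
    have h1 : 0 < α * κ := by positivity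
    have h2 : α * κ ≤ 1 := by nlinarith
    nlinarith
  refine ⟨A, hA, ?_⟩
  have hlog := Real.tendsto_log_atTop
  have ev4 := (hlog.comp (hlog.comp (hlog.comp hlog))).eventually_ge_atTop (8 * m + 8 : ℝ)
  have ev3 := (hlog.comp (hlog.comp hlog)).eventually_ge_atTop (8 * m + 8 : ℝ)
  have ev2 := (hlog.comp hlog).eventually_ge_atTop (2 / κ + 3 : ℝ)
  have ev1 := hlog.eventually_ge_atTop (2 : ℝ)
  have ev0 := Filter.eventually_ge_atTop (2 : ℝ)
  obtain ⟨x0, hx0⟩ := Filter.eventually_atTop.1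
    (ev4.and (ev3.and (ev2.and (ev1.and ev0))))
  refine ⟨x0, fun x hx Q hQ hu _ y hxy hyx hsum => ?_⟩
  obtain ⟨h4, h3, h2, h1, h0⟩ := hx0 x hx
  simp only [Function.comp_apply] at h4 h3 h2
  have hxpos : 0 < x := by linarith
  have hypos : 0 < y := (Real.rpow_pos_of_pos hxpos κ).trans_le hxy
  have hm0 : (0 : ℝ) ≤ m := Nat.cast_nonneg m
  set L := Real.log x with hL
  set L2 := Real.log L with hL2
  set L3 := Real.log L2 with hL3
  set L4 := Real.log L3 with hL4
  set u := L / Real.log Q with hu_def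
  have hlogQ : 0 < Real.log Q := Real.log_pos (by linarith)
  have hκ2 : 0 < 2 / κ := by positivity
  have hL2pos : 0 < L2 := by linarith
  have hQ_le : Real.log Q ≤ κ / 2 * L := by
    have h5 : 2 / κ ≤ u := by
      refine le_trans ?_ hu
      have h6 : L2 * 1 ≤ L2 * L2 := by gcongr; linarith
      linarith
    rw [hu_def, div_le_div_iff₀ hκ hlogQ] at h5
    linarith
  set S := x ^ (κ / 2) with hS_def
  have hS1 : 1 ≤ S := Real.one_le_rpow (by linarith) (by positivity)
  have hQS : Q ≤ S := by
    rw [← Real.log_le_log_iff (by linarith) (by linarith), Real.log_rpow hxpos]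
    exact hQ_le
  have hS2 : S ^ 2 = x ^ κ := by
    rw [hS_def, ← Real.rpow_natCast, ← Real.rpow_mul hxpos.le]
    congr 1
    push_cast
    ring
  have hSm : x + y ≤ S ^ m := by
    have h5 : x ^ (2 : ℝ) ≤ x ^ (κ / 2 * m) := by
      refine Real.rpow_le_rpow_of_exponent_le (by linarith) ?_
      rw [div_le_iff₀ hκ] at hm
      linarith
    rw [Real.rpow_two] at h5
    rw [hS_def, ← Real.rpow_natCast, ← Real.rpow_mul hxpos.le]
    nlinarith
  set F := (Finset.Icc 1 ⌊x + y⌋₊).filter (fun n : ℕ => x < (n : ℝ) ∧ (n : ℝ) ≤ x + y ∧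
    ∀ p ∈ n.primeFactors, (p : ℝ) ≤ Q) with hF_def
  have hF : ∀ n ∈ F, x < n ∧ (n : ℝ) ≤ x + y := fun n hn =>
    ⟨(mem_filter.1 hn).2.1, (mem_filter.1 hn).2.2.1⟩
  have hFS : ∀ n ∈ F, ∀ p ∈ n.primeFactors, (p : ℝ) ≤ S := fun n hn p hp =>
    ((mem_filter.1 hn).2.2.2 p hp).trans hQS
  set K : ℕ := ⌈2 * L3 / L4⌉₊ with hK_def
  have hL3pos : 0 < L3 := by linarith
  have hL4pos : 0 < L4 := by linarith
  have hK0 : K ≠ 0 := (Nat.ceil_pos.2 (by positivity)).ne'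
  have hK1 : 2 * L3 / L4 ≤ K := Nat.le_ceil _
  have hK2 : (K : ℝ) < 2 * L3 / L4 + 1 := Nat.ceil_lt_add_one (by positivity)
  have hmom := sum_card_divisors_pow_le_of_smooth hxpos.le hS1 (hS2.trans_le hxy) m (K + 1) hSm
    F hF hFS
  have hu1 : Real.exp 1 ≤ u := by
    have := Real.exp_one_lt_d9
    have h5 : 3 * 3 ≤ L2 * L2 := by gcongr <;> linarith
    linarith
  have hlogu : 1 ≤ Real.log u := (Real.le_log_iff_exp_le ((Real.exp_pos 1).trans_le hu1)).2 hu1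
  have hloglogu : 0 ≤ Real.log (Real.log u) := Real.log_nonneg hlogu
  set E := u * (Real.log u + Real.log (Real.log u) + A) with hE_def
  have huE : L2 ^ 2 ≤ E := by
    have h5 : 0 ≤ u := (sq_nonneg L2).trans hu
    exact hu.trans (le_mul_of_one_le_right h5 (by linarith))
  have hMexp : 2 * (1 + Real.log (S ^ 2)) ^ 2 ^ (m * (K + 1)) ≤ Real.exp (E / 2) := by
    have hlogS : Real.log (S ^ 2) ≤ L := by
      rw [hS2, Real.log_rpow hxpos]
      nlinarith
    exact moment_factor_le_exp h1 h3 h4 hK2.le (Real.log_nonneg (one_le_pow₀ hS1)) hlogS huE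
  have hc : 3 / 2 ≤ C3 * L4 / L3 * K := by
    have h5 : C3 * L4 / L3 * (2 * L3 / L4) = 2 * C3 := by field_simp
    have h6 : C3 * L4 / L3 * (2 * L3 / L4) ≤ C3 * L4 / L3 * K := by gcongr
    linarith
  have hE0 : 0 ≤ E := (sq_nonneg L2).trans huE
  have hfin := mul_exp_le_card_of_moment_le F (fun n => (#n.divisors : ℝ))
    (fun _ _ => Nat.cast_nonneg _) hypos hE0 hK0 hc
    (by simpa only [hE_def, neg_mul] using hsum) (hmom.trans (by gcongr))
  simpa only [hE_def, mul_assoc] using hfin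
end
end
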